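/- arXiv:1303.5609 — 13 statements merged into one kernel-verified Lean document; each statement's English description precedes it below -/
import Mathlib

section
/- Let F be a field and n ≥ 4 a natural number. Let x, y ∈ Fⁿ be linearly independent vectors and let θ, ζ ∈ Fⁿ be linearly independent vectors. Then θ⬝x = θ⬝y = ζ⬝x = ζ⬝y = 0 (where ⬝ is the standard dot product, i.e. the span of x and y is contained in the intersection of the kernels of the linear functionals v ↦ θ⬝v and v ↦ ζ⬝v) if and only if the matrix product (θ·ζᵀ − ζ·θᵀ)·(x·yᵀ − y·xᵀ) is the zero n×n matrix. -/
open Matrix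

/-- The product of the alternating matrices `θζᵀ − ζθᵀ` and `xyᵀ − yxᵀ`, with each column
written as a linear combination of `θ` and `ζ`. -/
theorem alternating_mul_alternating_apply {R ι : Type*} [CommRing R] [Fintype ι]
    (x y θ ζ : ι → R) (i j : ι) :
    ((vecMulVec θ ζ - vecMulVec ζ θ) * (vecMulVec x y - vecMulVec y x)) i j =
      ((ζ ⬝ᵥ x) * y j - (ζ ⬝ᵥ y) * x j) * θ i + ((θ ⬝ᵥ y) * x j - (θ ⬝ᵥ x) * y j) * ζ i := by
  simp only [Matrix.sub_mul, Matrix.mul_sub, vecMulVec_mul_vecMulVec, Matrix.sub_apply,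
    vecMulVec_apply, Pi.smul_apply, smul_eq_mul]
  ring

/-- Lemma 3.1: for linearly independent `x, y` and linearly independent
functionals `θ, ζ` (regarded as vectors of `Fⁿ` via the standard dot product),
the line `⟨x, y⟩` lies in `Ker θ ∩ Ker ζ` iff
`(θζᵀ − ζθᵀ)(xyᵀ − yxᵀ) = O`. -/
theorem stmt_0 (F : Type*) [Field F] (n : ℕ) (hn : 4 ≤ n)
    (x y θ ζ : Fin n → F)
    (hxy : LinearIndependent F ![x, y])
    (hθζ : LinearIndependent F ![θ, ζ]) :
    (θ ⬝ᵥ x = 0 ∧ θ ⬝ᵥ y = 0 ∧ ζ ⬝ᵥ x = 0 ∧ ζ ⬝ᵥ y = 0) ↔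
      (vecMulVec θ ζ - vecMulVec ζ θ) * (vecMulVec x y - vecMulVec y x) = 0 := by
  rw [LinearIndependent.pair_iff] at hxy hθζ
  constructor
  · rintro ⟨h₁, h₂, h₃, h₄⟩
    ext i j
    simp [alternating_mul_alternating_apply, h₁, h₂, h₃, h₄]
  · intro h
    have coeff_eq_zero (j : Fin n) := hθζ ((ζ ⬝ᵥ x) * y j - (ζ ⬝ᵥ y) * x j)
      ((θ ⬝ᵥ y) * x j - (θ ⬝ᵥ x) * y j) (by
        ext i
        simpa [alternating_mul_alternating_apply] using congrFun (congrFun h i) j)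
    obtain ⟨hζy, hζx⟩ := hxy (-(ζ ⬝ᵥ y)) (ζ ⬝ᵥ x) (by
      ext j
      simp only [Pi.add_apply, Pi.smul_apply, smul_eq_mul, Pi.zero_apply]
      linear_combination (coeff_eq_zero j).1)
    obtain ⟨hθy, hθx⟩ := hxy (θ ⬝ᵥ y) (-(θ ⬝ᵥ x)) (by
      ext j
      simp only [Pi.add_apply, Pi.smul_apply, smul_eq_mul, Pi.zero_apply]
      linear_combination (coeff_eq_zero j).2)
    exact ⟨neg_eq_zero.mp hθx, hθy, hζx, neg_eq_zero.mp hζy⟩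
end

section
/- Let x, y ∈ Fⁿ be linearly independent, let u, v ∈ Fⁿ be linearly independent, and set X = x·yᵀ − y·xᵀ and Y = u·vᵀ − v·uᵀ. Assume that the only vector w in the span of x and y with Φ·w = 0 is w = 0 (i.e. span{x,y} ∩ Rad(φ) = 0). Then φ(s, t) = 0 for all s ∈ span{x,y} and all t ∈ span{u,v} (i.e. span{u,v} ⊆ span{x,y}^⊥) if and only if Φ^σ · X^σ · Φ · Y = 0. In particular, span{x,y} is totally isotropic for φ if and only if Φ^σ · X^σ · Φ · X = 0. -/
open Matrix

/-- The entries of `Φ^σ X^σ Φ Y` for the bivectors `X = x yᵀ - y xᵀ` and `Y = u vᵀ - v uᵀ`. -/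
lemma bivector_product_apply {F ι : Type*} [Field F] [Fintype ι] (σ : F ≃+* F)
    (Φ : Matrix ι ι F) (x y u v : ι → F) (i j : ι) :
    (Φ.map σ * (vecMulVec x y - vecMulVec y x).map σ * Φ *
        (vecMulVec u v - vecMulVec v u)) i j =
      σ ((Φ *ᵥ x) i) *
          ((σ ∘ y) ⬝ᵥ (Φ *ᵥ u) * v j - (σ ∘ y) ⬝ᵥ (Φ *ᵥ v) * u j) -
        σ ((Φ *ᵥ y) i) *
          ((σ ∘ x) ⬝ᵥ (Φ *ᵥ u) * v j - (σ ∘ x) ⬝ᵥ (Φ *ᵥ v) * u j) := by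
  have hmap : (vecMulVec x y - vecMulVec y x).map σ =
      vecMulVec (σ ∘ x) (σ ∘ y) - vecMulVec (σ ∘ y) (σ ∘ x) := by
    ext k l
    simp [vecMulVec_apply]
  have hσ (z : ι → F) : (Φ.map σ *ᵥ (σ ∘ z)) i = σ ((Φ *ᵥ z) i) := by
    simp [mulVec, dotProduct]
  simp only [hmap, Matrix.mul_sub, Matrix.sub_mul, mul_vecMulVec, vecMulVec_mul,
    sub_mulVec, vecMulVec_mulVec, ← dotProduct_mulVec, Matrix.sub_apply, vecMulVec_apply,
    Pi.sub_apply, Pi.smul_apply, MulOpposite.smul_eq_mul_unop, MulOpposite.unop_op, hσ]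
  ring

/-- The span of `u, v` is orthogonal to the span of `x, y` iff the four generating pairs are. -/
lemma forall_mem_span_pair_sesquilinear_eq_zero_iff {F ι : Type*} [Field F] [Fintype ι]
    (σ : F ≃+* F) (Φ : Matrix ι ι F) (x y u v : ι → F) :
    (∀ s ∈ Submodule.span F {x, y}, ∀ t ∈ Submodule.span F {u, v},
        (σ ∘ s) ⬝ᵥ (Φ *ᵥ t) = 0) ↔
      ((σ ∘ x) ⬝ᵥ (Φ *ᵥ u) = 0 ∧ (σ ∘ x) ⬝ᵥ (Φ *ᵥ v) = 0) ∧
        (σ ∘ y) ⬝ᵥ (Φ *ᵥ u) = 0 ∧ (σ ∘ y) ⬝ᵥ (Φ *ᵥ v) = 0 := by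
  constructor
  · intro h
    have hx : x ∈ Submodule.span F {x, y} := Submodule.subset_span (by simp)
    have hy : y ∈ Submodule.span F {x, y} := Submodule.subset_span (by simp)
    have hu : u ∈ Submodule.span F {u, v} := Submodule.subset_span (by simp)
    have hv : v ∈ Submodule.span F {u, v} := Submodule.subset_span (by simp)
    exact ⟨⟨h x hx u hu, h x hx v hv⟩, h y hy u hu, h y hy v hv⟩
  · rintro ⟨⟨hxu, hxv⟩, hyu, hyv⟩ s hs t ht
    obtain ⟨a, b, rfl⟩ := Submodule.mem_span_pair.1 hs
    obtain ⟨c, d, rfl⟩ := Submodule.mem_span_pair.1 ht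
    have hσ : σ ∘ (a • x + b • y) = σ a • (σ ∘ x) + σ b • (σ ∘ y) := by
      ext k
      simp
    simp [hσ, mulVec_add, mulVec_smul, hxu, hxv, hyu, hyv]

/-- If the span of `x, y` meets the kernel of `Φ` trivially, the span of `u, v` is orthogonal to
it iff `Φ^σ X^σ Φ Y = 0`. -/
lemma orthogonal_span_pair_iff_bivector_product_eq_zero {F ι : Type*} [Field F] [Fintype ι]
    (σ : F ≃+* F) (hσ : ∀ t, σ (σ t) = t) (Φ : Matrix ι ι F) (x y u v : ι → F)
    (hxy : LinearIndependent F ![x, y]) (huv : LinearIndependent F ![u, v])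
    (hrad : ∀ w ∈ Submodule.span F {x, y}, Φ *ᵥ w = 0 → w = 0) :
    (∀ s ∈ Submodule.span F {x, y}, ∀ t ∈ Submodule.span F {u, v},
        (σ ∘ s) ⬝ᵥ (Φ *ᵥ t) = 0) ↔
      Φ.map σ * (vecMulVec x y - vecMulVec y x).map σ * Φ *
        (vecMulVec u v - vecMulVec v u) = 0 := by
  rw [forall_mem_span_pair_sesquilinear_eq_zero_iff]
  rw [LinearIndependent.pair_iff] at hxy huv
  constructor
  · rintro ⟨⟨hxu, hxv⟩, hyu, hyv⟩
    ext i j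
    rw [bivector_product_apply]
    simp [hxu, hxv, hyu, hyv]
  · intro h
    have hΦxy (r s : F) (hrs : ∀ i, σ ((Φ *ᵥ x) i) * r - σ ((Φ *ᵥ y) i) * s = 0) :
        r = 0 ∧ s = 0 := by
      have hw : Φ *ᵥ (σ r • x + (-σ s) • y) = 0 := by
        ext i
        have := congrArg σ (hrs i)
        simp only [map_sub, map_mul, hσ, map_zero] at this
        simp only [mulVec_add, mulVec_smul, Pi.add_apply, Pi.smul_apply, smul_eq_mul,
          Pi.zero_apply]
        linear_combination this
      simpa using hxy _ _ (hrad _ (Submodule.mem_span_pair.2 ⟨_, _, rfl⟩) hw)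
    have huv_zero (a b : F) (hab : ∀ j, a * v j - b * u j = 0) : a = 0 ∧ b = 0 := by
      have := huv (-b) a (by
        ext j
        simp only [Pi.add_apply, Pi.smul_apply, smul_eq_mul, Pi.zero_apply]
        linear_combination hab j)
      simpa [and_comm] using this
    have hcoeff j := hΦxy _ _ fun i =>
      (bivector_product_apply σ Φ x y u v i j).symm.trans (congrFun (congrFun h i) j)
    exact ⟨huv_zero _ _ fun j => (hcoeff j).2, huv_zero _ _ fun j => (hcoeff j).1⟩

/-- Theorem 3.2: with `S = ⟨x,y⟩` meeting the radical of `φ` trivially,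
`⟨u,v⟩ ⊆ S^⊥` iff `Φ^σ X^σ Φ Y = O`; in particular `S` is totally isotropic
iff `Φ^σ X^σ Φ X = O`. -/
theorem stmt_1 (F : Type*) [Field F] (n : ℕ) (hn : 4 ≤ n)
    (σ : F ≃+* F) (hσ : ∀ t, σ (σ t) = t)
    (ε : F) (hε : σ ε * ε = 1)
    (Φ : Matrix (Fin n) (Fin n) F) (hΦ : Φᵀ = ε • Φ.map σ)
    (φ : (Fin n → F) → (Fin n → F) → F)
    (hφ : ∀ a b, φ a b = (fun i => σ (a i)) ⬝ᵥ (Φ *ᵥ b))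
    (x y u v : Fin n → F)
    (hxy : LinearIndependent F ![x, y])
    (huv : LinearIndependent F ![u, v])
    (hrad : ∀ w ∈ Submodule.span F {x, y}, Φ *ᵥ w = 0 → w = 0)
    (X Y : Matrix (Fin n) (Fin n) F)
    (hX : X = vecMulVec x y - vecMulVec y x)
    (hY : Y = vecMulVec u v - vecMulVec v u) :
    ((∀ s ∈ Submodule.span F {x, y}, ∀ t ∈ Submodule.span F {u, v}, φ s t = 0) ↔
        Φ.map σ * X.map σ * Φ * Y = 0) ∧
    ((∀ s ∈ Submodule.span F {x, y}, ∀ t ∈ Submodule.span F {x, y}, φ s t = 0) ↔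
        Φ.map σ * X.map σ * Φ * X = 0) := by
  subst hX hY
  simp only [hφ]
  exact ⟨orthogonal_span_pair_iff_bivector_product_eq_zero σ hσ Φ x y u v hxy huv hrad,
    orthogonal_span_pair_iff_bivector_product_eq_zero σ hσ Φ x y x y hxy hxy hrad⟩
end

section
/- Assume the matrix Φ is invertible (i.e. φ is non-degenerate). Let x, y ∈ Fⁿ be linearly independent, let u, v ∈ Fⁿ be linearly independent, and set X = x·yᵀ − y·xᵀ and Y = u·vᵀ − v·uᵀ. Then φ(s, t) = 0 for all s ∈ span{x,y} and all t ∈ span{u,v} if and only if X^σ · Φ · Y = 0. In particular, span{x,y} is totally isotropic for φ if and only if X^σ · Φ · X = 0. -/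
open Matrix

theorem vecMulVec_sub_vecMulVec_eq_zero_iff {F ι κ : Type*} [Field F] {a b : ι → F}
    (hab : LinearIndependent F ![a, b]) {p q : κ → F} :
    vecMulVec a p - vecMulVec b q = 0 ↔ p = 0 ∧ q = 0 := by
  refine ⟨fun h => ?_, fun ⟨hp, hq⟩ => by ext; simp [hp, hq, vecMulVec_apply]⟩
  have key (j : κ) : p j = 0 ∧ -q j = 0 := by
    refine LinearIndependent.pair_iff.mp hab _ _ (funext fun i => ?_)
    have hij := congrFun (congrFun h i) j
    simp only [Matrix.sub_apply, vecMulVec_apply, Matrix.zero_apply] at hij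
    simp only [Pi.add_apply, Pi.smul_apply, smul_eq_mul, Pi.zero_apply]
    linear_combination hij
  exact ⟨funext fun j => (key j).1, funext fun j => neg_eq_zero.mp (key j).2⟩

theorem linearIndependent_pair_comp_ringEquiv {F ι : Type*} [Field F] (σ : F ≃+* F)
    {x y : ι → F} (hxy : LinearIndependent F ![x, y]) :
    LinearIndependent F ![σ ∘ x, σ ∘ y] := by
  refine LinearIndependent.pair_iff.mpr fun s t hst => ?_
  have h := LinearIndependent.pair_iff.mp hxy (σ.symm s) (σ.symm t) (funext fun i => by
    have hi := congrArg σ.symm (congrFun hst i)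
    simpa using hi)
  simpa using h

theorem smul_sub_smul_eq_zero_iff {F V : Type*} [Field F] [AddCommGroup V] [Module F V]
    {u v : V} (huv : LinearIndependent F ![u, v]) {c d : F} :
    c • v - d • u = 0 ↔ c = 0 ∧ d = 0 := by
  refine ⟨fun h => ?_, fun ⟨hc, hd⟩ => by simp [hc, hd]⟩
  have := LinearIndependent.pair_iff.mp huv (-d) c (by rw [← h]; module)
  exact ⟨this.2, neg_eq_zero.mp this.1⟩

theorem map_mul_mul_eq_zero_iff {F ι : Type*} [Field F] [Fintype ι] (σ : F ≃+* F)
    (Φ : Matrix ι ι F) {x y u v : ι → F}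
    (hxy : LinearIndependent F ![x, y]) (huv : LinearIndependent F ![u, v]) :
    (vecMulVec x y - vecMulVec y x).map σ * Φ * (vecMulVec u v - vecMulVec v u) = 0 ↔
      ((σ ∘ y) ⬝ᵥ (Φ *ᵥ u) = 0 ∧ (σ ∘ y) ⬝ᵥ (Φ *ᵥ v) = 0) ∧
        (σ ∘ x) ⬝ᵥ (Φ *ᵥ u) = 0 ∧ (σ ∘ x) ⬝ᵥ (Φ *ᵥ v) = 0 := by
  have hmap : (vecMulVec x y - vecMulVec y x).map σ =
      vecMulVec (σ ∘ x) (σ ∘ y) - vecMulVec (σ ∘ y) (σ ∘ x) := by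
    ext i j
    simp [vecMulVec_apply]
  have hprod : (vecMulVec x y - vecMulVec y x).map σ * Φ * (vecMulVec u v - vecMulVec v u) =
      vecMulVec (σ ∘ x) (((σ ∘ y) ⬝ᵥ (Φ *ᵥ u)) • v - ((σ ∘ y) ⬝ᵥ (Φ *ᵥ v)) • u) -
        vecMulVec (σ ∘ y) (((σ ∘ x) ⬝ᵥ (Φ *ᵥ u)) • v - ((σ ∘ x) ⬝ᵥ (Φ *ᵥ v)) • u) := by
    rw [hmap, Matrix.mul_assoc, Matrix.mul_sub, mul_vecMulVec, mul_vecMulVec]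
    simp only [Matrix.sub_mul, Matrix.mul_sub, vecMulVec_mul_vecMulVec, vecMulVec_sub]
    abel
  rw [hprod, vecMulVec_sub_vecMulVec_eq_zero_iff (linearIndependent_pair_comp_ringEquiv σ hxy),
    smul_sub_smul_eq_zero_iff huv, smul_sub_smul_eq_zero_iff huv]

theorem forall_span_pair_dotProduct_eq_zero_iff {F ι : Type*} [Field F] [Fintype ι]
    (σ : F ≃+* F) (Φ : Matrix ι ι F) (x y u v : ι → F) :
    (∀ s ∈ Submodule.span F {x, y}, ∀ t ∈ Submodule.span F {u, v},
        (σ ∘ s) ⬝ᵥ (Φ *ᵥ t) = 0) ↔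
      ((σ ∘ y) ⬝ᵥ (Φ *ᵥ u) = 0 ∧ (σ ∘ y) ⬝ᵥ (Φ *ᵥ v) = 0) ∧
        (σ ∘ x) ⬝ᵥ (Φ *ᵥ u) = 0 ∧ (σ ∘ x) ⬝ᵥ (Φ *ᵥ v) = 0 := by
  constructor
  · intro h
    have hx : x ∈ Submodule.span F {x, y} := Submodule.mem_span_of_mem (by simp)
    have hy : y ∈ Submodule.span F {x, y} := Submodule.mem_span_of_mem (by simp)
    have hu : u ∈ Submodule.span F {u, v} := Submodule.mem_span_of_mem (by simp)
    have hv : v ∈ Submodule.span F {u, v} := Submodule.mem_span_of_mem (by simp)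
    exact ⟨⟨h y hy u hu, h y hy v hv⟩, h x hx u hu, h x hx v hv⟩
  · rintro ⟨⟨hyu, hyv⟩, hxu, hxv⟩ s hs t ht
    obtain ⟨a, b, rfl⟩ := Submodule.mem_span_pair.mp hs
    obtain ⟨c, d, rfl⟩ := Submodule.mem_span_pair.mp ht
    have hσ : σ ∘ (a • x + b • y) = σ a • (σ ∘ x) + σ b • (σ ∘ y) := by
      ext i
      simp
    simp [hσ, mulVec_add, mulVec_smul, hyu, hyv, hxu, hxv]

/-- Corollary 3.3: for non-degenerate `φ` (i.e. invertible `Φ`),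
`⟨u,v⟩ ⊆ ⟨x,y⟩^⊥` iff `X^σ Φ Y = O`; in particular `⟨x,y⟩` is totally
isotropic iff `X^σ Φ X = O`. -/
theorem stmt_2 (F : Type*) [Field F] (n : ℕ) (hn : 4 ≤ n)
    (σ : F ≃+* F) (hσ : ∀ t, σ (σ t) = t)
    (ε : F) (hε : σ ε * ε = 1)
    (Φ : Matrix (Fin n) (Fin n) F) (hΦ : Φᵀ = ε • Φ.map σ)
    (hΦunit : IsUnit Φ)
    (φ : (Fin n → F) → (Fin n → F) → F)
    (hφ : ∀ a b, φ a b = (fun i => σ (a i)) ⬝ᵥ (Φ *ᵥ b))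
    (x y u v : Fin n → F)
    (hxy : LinearIndependent F ![x, y])
    (huv : LinearIndependent F ![u, v])
    (X Y : Matrix (Fin n) (Fin n) F)
    (hX : X = vecMulVec x y - vecMulVec y x)
    (hY : Y = vecMulVec u v - vecMulVec v u) :
    ((∀ s ∈ Submodule.span F {x, y}, ∀ t ∈ Submodule.span F {u, v}, φ s t = 0) ↔
        X.map σ * Φ * Y = 0) ∧
    ((∀ s ∈ Submodule.span F {x, y}, ∀ t ∈ Submodule.span F {x, y}, φ s t = 0) ↔
        X.map σ * Φ * X = 0) := by
  have main {a b c d : Fin n → F} (hab : LinearIndependent F ![a, b])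
      (hcd : LinearIndependent F ![c, d]) :
      (∀ s ∈ Submodule.span F {a, b}, ∀ t ∈ Submodule.span F {c, d}, φ s t = 0) ↔
        (vecMulVec a b - vecMulVec b a).map σ * Φ * (vecMulVec c d - vecMulVec d c) = 0 := by
    rw [map_mul_mul_eq_zero_iff σ Φ hab hcd,
      ← forall_span_pair_dotProduct_eq_zero_iff σ Φ a b c d]
    simp only [hφ]
    rfl
  subst hX hY
  exact ⟨main hxy huv, main hxy hxy⟩
end

section
/- Let x, y ∈ Fⁿ be linearly independent and set X = x·yᵀ − y·xᵀ. Then the span of x and y contains a nonzero vector w with Φ·w = 0 (i.e. span{x,y} ∩ Rad(φ) ≠ 0) if and only if Φ · X · Φ^σ = 0. -/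
open Matrix

theorem vecMulVec_sub_vecMulVec_comm_eq_zero_iff {F ι : Type*} [Field F] (u v : ι → F) :
    vecMulVec u v - vecMulVec v u = 0 ↔ ¬ LinearIndependent F ![u, v] := by
  have entry : vecMulVec u v - vecMulVec v u = 0 ↔ ∀ i j, u i * v j - v i * u j = 0 := by
    simp [← Matrix.ext_iff, vecMulVec_apply]
  rw [entry, LinearIndependent.pair_iff]
  push Not
  constructor
  · intro h
    by_cases hu : u = 0
    · exact ⟨1, 0, by simp [hu], by simp⟩
    · obtain ⟨i, hi⟩ := Function.ne_iff.mp hu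
      refine ⟨v i, -u i, ?_, fun _ => neg_ne_zero.mpr hi⟩
      ext j
      simp only [Pi.add_apply, Pi.smul_apply, smul_eq_mul, Pi.zero_apply]
      linear_combination -h i j
  · rintro ⟨a, b, hab, hne⟩ i j
    have hi := congrFun hab i
    have hj := congrFun hab j
    simp only [Pi.add_apply, Pi.smul_apply, smul_eq_mul, Pi.zero_apply] at hi hj
    by_cases ha : a = 0
    · refine (mul_eq_zero.mp ?_).resolve_left (hne ha)
      linear_combination u i * hj - u j * hi
    · refine (mul_eq_zero.mp ?_).resolve_left ha
      linear_combination v j * hi - v i * hj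

theorem exists_mem_span_pair_mulVec_eq_zero_iff {F m n : Type*} [Field F] [Fintype n]
    (A : Matrix m n F) {x y : n → F} (hxy : LinearIndependent F ![x, y]) :
    (∃ w ∈ Submodule.span F {x, y}, w ≠ 0 ∧ A *ᵥ w = 0) ↔
      ¬ LinearIndependent F ![A *ᵥ x, A *ᵥ y] := by
  rw [LinearIndependent.pair_iff] at hxy ⊢
  push Not
  constructor
  · rintro ⟨w, hw, hw0, hAw⟩
    obtain ⟨a, b, rfl⟩ := Submodule.mem_span_pair.mp hw
    refine ⟨a, b, by simpa [mulVec_add, mulVec_smul] using hAw, ?_⟩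
    rintro rfl rfl
    simp at hw0
  · rintro ⟨a, b, hab, hne⟩
    refine ⟨a • x + b • y, Submodule.mem_span_pair.mpr ⟨a, b, rfl⟩, fun h => ?_, ?_⟩
    · exact hne (hxy a b h).1 (hxy a b h).2
    · simpa [mulVec_add, mulVec_smul] using hab

/-- Corollary 3.4: `⟨x,y⟩ ∩ Rad(φ) ≠ 0` iff `Φ X Φ^σ = O`. -/
theorem stmt_3 (F : Type*) [Field F] (n : ℕ) (hn : 4 ≤ n)
    (σ : F ≃+* F) (hσ : ∀ t, σ (σ t) = t)
    (ε : F) (hε : σ ε * ε = 1)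
    (Φ : Matrix (Fin n) (Fin n) F) (hΦ : Φᵀ = ε • Φ.map σ)
    (x y : Fin n → F)
    (hxy : LinearIndependent F ![x, y])
    (X : Matrix (Fin n) (Fin n) F)
    (hX : X = vecMulVec x y - vecMulVec y x) :
    (∃ w ∈ Submodule.span F {x, y}, w ≠ 0 ∧ Φ *ᵥ w = 0) ↔
      Φ * X * Φ.map σ = 0 := by
  have hε0 : ε ≠ 0 := right_ne_zero_of_mul_eq_one hε
  have key : ε • (Φ * X * Φ.map σ) =
      vecMulVec (Φ *ᵥ x) (Φ *ᵥ y) - vecMulVec (Φ *ᵥ y) (Φ *ᵥ x) := by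
    rw [← Matrix.mul_smul, ← hΦ, hX, Matrix.mul_sub, Matrix.sub_mul, mul_vecMulVec, mul_vecMulVec,
      vecMulVec_mul, vecMulVec_mul, vecMul_transpose, vecMul_transpose]
  rw [exists_mem_span_pair_mulVec_eq_zero_iff Φ hxy, ← vecMulVec_sub_vecMulVec_comm_eq_zero_iff,
    ← key, smul_eq_zero_iff_right hε0]
end

section
/- Assume: (i) Φ is invertible (φ is non-degenerate); (ii) φ is trace-valued, i.e. for every x ∈ Fⁿ there exists t ∈ F with φ(x,x) = t + ε·σ(t); (iii) φ is not alternating, i.e. there exists x ∈ Fⁿ with φ(x,x) ≠ 0; (iv) φ has Witt index at least 2, i.e. there exist linearly independent x, y ∈ Fⁿ whose span is totally isotropic for φ. Then the F-linear span of the set of matrices {x·yᵀ − y·xᵀ : x, y ∈ Fⁿ linearly independent and span{x,y} totally isotropic for φ} is the full space of alternating n×n matrices, i.e. the subspace {A : Aᵀ = −A and all diagonal entries of A are 0}, which has dimension n(n−1)/2. -/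
open Matrix

section Form

variable {F V M : Type*} [Field F] [AddCommGroup V] [Module F V] [AddCommGroup M] [Module F M]
  {σ : F ≃+* F} {ε : F} {φ : V →ₛₗ[(σ : F →+* F)] V →ₗ[F] F} {B : V →ₗ[F] V →ₗ[F] M}

theorem swap_eq_zero (hsymm : ∀ x y, φ y x = ε * σ (φ x y)) {x y : V} (h : φ x y = 0) :
    φ y x = 0 := by
  simp [hsymm x y, h]

/-- In a reflexive trace-valued space, a vector `y` with `φ e y = 1` for an isotropic `e` becomes
isotropic after adding a multiple of `e`. -/
theorem exists_isotropic_sub_smul (hσ : ∀ t, σ (σ t) = t)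
    (hsymm : ∀ x y, φ y x = ε * σ (φ x y)) (htrace : ∀ x, ∃ t, φ x x = t + ε * σ t)
    {e y : V} (he : φ e e = 0) (hey : φ e y = 1) : ∃ s : F, φ (y - s • e) (y - s • e) = 0 := by
  obtain ⟨t, ht⟩ := htrace y
  have hye : φ y e = ε := by simp [hsymm e y, hey]
  exact ⟨σ t, by simp [ht, he, hey, hye, hσ, mul_comm]⟩

theorem exists_hyperbolic_frame (hσ : ∀ t, σ (σ t) = t) (hε : σ ε * ε = 1)
    (hsymm : ∀ x y, φ y x = ε * σ (φ x y)) (htrace : ∀ x, ∃ t, φ x x = t + ε * σ t)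
    {e₁ e₂ : V} (h₁₁ : φ e₁ e₁ = 0) (h₁₂ : φ e₁ e₂ = 0) (h₂₂ : φ e₂ e₂ = 0)
    (hf : ∃ y, φ e₁ y = 1 ∧ φ e₂ y = 0) (hf' : ∃ y, φ e₁ y = 0 ∧ φ e₂ y = 1) :
    ∃ f₁ f₂ : V, φ f₁ f₁ = 0 ∧ φ f₂ f₂ = 0 ∧ φ f₁ f₂ = 0 ∧
      φ e₁ f₁ = 1 ∧ φ e₂ f₂ = 1 ∧ φ e₁ f₂ = 0 ∧ φ e₂ f₁ = 0 := by
  obtain ⟨y, hy₁, hy₂⟩ := hf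
  obtain ⟨z, hz₁, hz₂⟩ := hf'
  have h₂₁ : φ e₂ e₁ = 0 := swap_eq_zero hsymm h₁₂
  obtain ⟨s, hs⟩ := exists_isotropic_sub_smul hσ hsymm htrace h₁₁ hy₁
  set f₁ := y - s • e₁ with hf₁
  have he₁f₁ : φ e₁ f₁ = 1 := by simp [hf₁, h₁₁, hy₁]
  have he₂f₁ : φ e₂ f₁ = 0 := by simp [hf₁, h₂₁, hy₂]
  have hf₁e₁ : φ f₁ e₁ = ε := by simp [hsymm e₁ f₁, he₁f₁]
  have hf₁e₂ : φ f₁ e₂ = 0 := swap_eq_zero hsymm he₂f₁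
  clear_value f₁
  set z' := z - (φ f₁ z * σ ε) • e₁ with hz'
  have hz'₁ : φ e₁ z' = 0 := by simp [hz', h₁₁, hz₁]
  have hz'₂ : φ e₂ z' = 1 := by simp [hz', h₂₁, hz₂]
  have hf₁z' : φ f₁ z' = 0 := by simp [hz', hf₁e₁, mul_assoc, hε]
  obtain ⟨r, hr⟩ := exists_isotropic_sub_smul hσ hsymm htrace h₂₂ hz'₂
  exact ⟨f₁, z' - r • e₂, hs, hr, by simp [hf₁z', hf₁e₂], he₁f₁, by simp [hz'₂, h₂₂],
    by simp [hz'₁, h₁₂], he₂f₁⟩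

/-- A bilinear map vanishing on orthogonal isotropic pairs vanishes at `(x, w)` as soon as `x` is
isotropic, `w` is orthogonal to `x`, and both are orthogonal to a common hyperbolic pair. -/
theorem apply_eq_zero_of_orthogonal_hyperbolic
    (hsymm : ∀ x y, φ y x = ε * σ (φ x y)) (htrace : ∀ x, ∃ t, φ x x = t + ε * σ t)
    (hB : ∀ x y, φ x x = 0 → φ y y = 0 → φ x y = 0 → B x y = 0)
    {e f x w : V} (he : φ e e = 0) (hf : φ f f = 0) (hef : φ e f = 1)
    (hx : φ x x = 0) (hxe : φ x e = 0) (hxf : φ x f = 0)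
    (hew : φ e w = 0) (hfw : φ f w = 0) (hxw : φ x w = 0) : B x w = 0 := by
  obtain ⟨t, ht⟩ := htrace w
  have hfe : φ f e = ε := by simp [hsymm e f, hef]
  have hwe : φ w e = 0 := swap_eq_zero hsymm hew
  have hwf : φ w f = 0 := swap_eq_zero hsymm hfw
  have h := hB x (w + e - t • f) hx
    (by simp [ht, he, hf, hef, hfe, hwe, hwf, hew, hfw]; ring) (by simp [hxw, hxe, hxf])
  simpa [hB x e hx he hxe, hB x f hx hf hxf] using h

/-- An alternating bilinear map which vanishes on the orthogonal isotropic pairs of a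
trace-valued non-alternating form containing two orthogonal hyperbolic planes is zero. -/
theorem eq_zero_of_vanish_on_isotropic_pairs (hε : σ ε * ε = 1)
    (hsymm : ∀ x y, φ y x = ε * σ (φ x y)) (htrace : ∀ x, ∃ t, φ x x = t + ε * σ t)
    (hnonalt : ∃ x, φ x x ≠ 0) (hBalt : ∀ x, B x x = 0)
    (hB : ∀ x y, φ x x = 0 → φ y y = 0 → φ x y = 0 → B x y = 0)
    {e₁ e₂ f₁ f₂ : V} (he₁ : φ e₁ e₁ = 0) (he₂ : φ e₂ e₂ = 0) (hf₁ : φ f₁ f₁ = 0)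
    (hf₂ : φ f₂ f₂ = 0) (he₁e₂ : φ e₁ e₂ = 0) (hf₁f₂ : φ f₁ f₂ = 0) (he₁f₁ : φ e₁ f₁ = 1)
    (he₂f₂ : φ e₂ f₂ = 1) (he₁f₂ : φ e₁ f₂ = 0) (he₂f₁ : φ e₂ f₁ = 0) (x y : V) :
    B x y = 0 := by
  have hBswap (x y : V) : B y x = -B x y := by
    have h := hBalt (x + y)
    simp only [map_add, LinearMap.add_apply, hBalt, zero_add, add_zero] at h
    exact eq_neg_of_add_eq_zero_left h
  have he₂e₁ := swap_eq_zero hsymm he₁e₂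
  have hf₂f₁ := swap_eq_zero hsymm hf₁f₂
  have hf₂e₁ := swap_eq_zero hsymm he₁f₂
  have hf₁e₂ := swap_eq_zero hsymm he₂f₁
  have hf₁e₁ : φ f₁ e₁ = ε := by simp [hsymm e₁ f₁, he₁f₁]
  have hf₂e₂ : φ f₂ e₂ = ε := by simp [hsymm e₂ f₂, he₂f₂]
  have hBe₁e₂ := hB _ _ he₁ he₂ he₁e₂
  have hBe₁f₂ := hB _ _ he₁ hf₂ he₁f₂
  have hBf₁e₂ := hB _ _ hf₁ he₂ hf₁e₂
  have hBf₁f₂ := hB _ _ hf₁ hf₂ hf₁f₂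
  have hBe₂e₁ := hB _ _ he₂ he₁ he₂e₁
  have hBf₂e₁ := hB _ _ hf₂ he₁ hf₂e₁
  have hBe₂f₁ := hB _ _ he₂ hf₁ he₂f₁
  have hBf₂f₁ := hB _ _ hf₂ hf₁ hf₂f₁
  obtain ⟨hB₁, hB₂⟩ : B e₁ f₁ = 0 ∧ B e₂ f₂ = 0 := by
    have hscale (a : F) : a • B e₁ f₁ = σ a • B e₂ f₂ := by
      have h := hB (a • e₁ + e₂) (f₁ - σ a • f₂)
        (by simp [*, -hsymm, -hBswap, -hB])
        (by simp [*, -hsymm, -hBswap, -hB])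
        (by simp [*, -hsymm, -hBswap, -hB])
      exact sub_eq_zero.1 (by simpa [hBe₁f₂, hBe₂f₁, sub_eq_add_neg] using h)
    have hB₂ : B e₂ f₂ = B e₁ f₁ := by simpa using (hscale 1).symm
    have hflip : B e₁ f₁ = -(σ ε • B e₁ f₁) := by
      have h := hB (e₁ + f₂) (f₁ - σ ε • e₂)
        (by simp [*, -hsymm, -hBswap, -hB])
        (by simp [*, -hsymm, -hBswap, -hB])
        (by simp [*, -hsymm, -hBswap, -hB])
      rw [← hB₂, ← smul_neg, ← hBswap e₂ f₂, hB₂]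
      exact sub_eq_zero.1 (by simpa [hBe₁e₂, hBf₂f₁, sub_eq_add_neg] using h)
    have hB₁ : B e₁ f₁ = 0 := by
      by_contra hne
      have hid (a : F) : σ a = a := by
        have h := hscale a
        rw [hB₂] at h
        exact (smul_left_injective F hne h).symm
      have hε' : ε = -1 := by
        have h : (1 : F) • B e₁ f₁ = (-ε) • B e₁ f₁ := by
          rw [one_smul, neg_smul]; simpa [hid] using hflip
        have := smul_left_injective F hne h
        rw [this, neg_neg]
      obtain ⟨x, hx⟩ := hnonalt
      obtain ⟨t, ht⟩ := htrace x
      exact hx (by simp [ht, hid, hε'])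
    exact ⟨hB₁, hB₂.trans hB₁⟩
  have hB₁' : B f₁ e₁ = 0 := by rw [hBswap e₁ f₁, hB₁, neg_zero]
  have hB₂' : B f₂ e₂ = 0 := by rw [hBswap e₂ f₂, hB₂, neg_zero]
  have hdecomp (v : V) : ∃ (w : V) (a b c d : F), v = w + a • e₁ + b • f₁ + c • e₂ + d • f₂ ∧
      φ e₁ w = 0 ∧ φ f₁ w = 0 ∧ φ e₂ w = 0 ∧ φ f₂ w = 0 := by
    refine ⟨v - (φ f₁ v * σ ε) • e₁ - φ e₁ v • f₁ - (φ f₂ v * σ ε) • e₂ - φ e₂ v • f₂,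
      φ f₁ v * σ ε, φ e₁ v, φ f₂ v * σ ε, φ e₂ v, by abel, ?_, ?_, ?_, ?_⟩ <;>
    simp [mul_assoc, *, -hsymm, -hBswap, -hB]
  obtain ⟨w, a, b, c, d, rfl, hw₁, hw₂, hw₃, hw₄⟩ := hdecomp x
  obtain ⟨w', a', b', c', d', rfl, hw₁', hw₂', hw₃', hw₄'⟩ := hdecomp y
  have hBw {w : V} (h₁ : φ e₁ w = 0) (h₂ : φ f₁ w = 0) (h₃ : φ e₂ w = 0) (h₄ : φ f₂ w = 0) :
      B e₁ w = 0 ∧ B f₁ w = 0 ∧ B e₂ w = 0 ∧ B f₂ w = 0 :=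
    ⟨apply_eq_zero_of_orthogonal_hyperbolic hsymm htrace hB he₂ hf₂ he₂f₂ he₁ he₁e₂ he₁f₂ h₃ h₄ h₁,
      apply_eq_zero_of_orthogonal_hyperbolic hsymm htrace hB he₂ hf₂ he₂f₂ hf₁ hf₁e₂ hf₁f₂ h₃ h₄ h₂,
      apply_eq_zero_of_orthogonal_hyperbolic hsymm htrace hB he₁ hf₁ he₁f₁ he₂ he₂e₁ he₂f₁ h₁ h₂ h₃,
      apply_eq_zero_of_orthogonal_hyperbolic hsymm htrace hB he₁ hf₁ he₁f₁ hf₂ hf₂e₁ hf₂f₁ h₁ h₂ h₄⟩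
  obtain ⟨k₁, k₂, k₃, k₄⟩ := hBw hw₁ hw₂ hw₃ hw₄
  obtain ⟨k₁', k₂', k₃', k₄'⟩ := hBw hw₁' hw₂' hw₃' hw₄'
  have hwe₁ : B w e₁ = 0 := by rw [hBswap e₁ w, k₁, neg_zero]
  have hwf₁ : B w f₁ = 0 := by rw [hBswap f₁ w, k₂, neg_zero]
  have hwe₂ : B w e₂ = 0 := by rw [hBswap e₂ w, k₃, neg_zero]
  have hwf₂ : B w f₂ = 0 := by rw [hBswap f₂ w, k₄, neg_zero]
  have hww' : B w w' = 0 := by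
    obtain ⟨t, ht⟩ := htrace w
    obtain ⟨t', ht'⟩ := htrace w'
    have z₁ := swap_eq_zero hsymm hw₁
    have z₂ := swap_eq_zero hsymm hw₂
    have z₃ := swap_eq_zero hsymm hw₃
    have z₄ := swap_eq_zero hsymm hw₄
    have z₁' := swap_eq_zero hsymm hw₁'
    have z₂' := swap_eq_zero hsymm hw₂'
    have z₃' := swap_eq_zero hsymm hw₃'
    have z₄' := swap_eq_zero hsymm hw₄'
    have h := hB (w + e₁ - t • f₁) (w' - φ w w' • f₁ + e₂ - t' • f₂)
      (by simp [*, -hsymm, -hBswap, -hB]; ring)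
      (by simp [*, -hsymm, -hBswap, -hB]; ring)
      (by simp [*, -hsymm, -hBswap, -hB])
    simpa [*, -hsymm, -hBswap, -hB] using h
  simp [*, -hsymm, -hBswap, -hB]

end Form

section Alternating

variable (F : Type*) [Field F] (n : ℕ)

/-- The space of alternating matrices. -/
def alternatingMatrices : Submodule F (Matrix (Fin n) (Fin n) F) where
  carrier := {A | Aᵀ = -A ∧ ∀ i, A i i = 0}
  add_mem' := by
    rintro A B ⟨hA, hA'⟩ ⟨hB, hB'⟩
    exact ⟨by rw [transpose_add, hA, hB, neg_add], fun i => by simp [hA', hB']⟩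
  zero_mem' := by simp
  smul_mem' := by
    rintro c A ⟨hA, hA'⟩
    exact ⟨by rw [transpose_smul, hA, smul_neg], fun i => by simp [hA']⟩

/-- The bilinear map `(x, y) ↦ xyᵀ − yxᵀ`. -/
def wedgeMatrix : (Fin n → F) →ₗ[F] (Fin n → F) →ₗ[F] Matrix (Fin n) (Fin n) F :=
  vecMulVecBilin F F - (vecMulVecBilin F F).flip

variable {F n}

theorem wedgeMatrix_apply (x y : Fin n → F) :
    wedgeMatrix F n x y = vecMulVec x y - vecMulVec y x := rfl

theorem wedgeMatrix_self (x : Fin n → F) : wedgeMatrix F n x x = 0 := by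
  simp [wedgeMatrix_apply]

theorem wedgeMatrix_mem_alternatingMatrices (x y : Fin n → F) :
    wedgeMatrix F n x y ∈ alternatingMatrices F n := by
  refine ⟨?_, fun i => ?_⟩
  · simp [wedgeMatrix_apply, transpose_vecMulVec]
  · simp [wedgeMatrix_apply, vecMulVec_apply, mul_comm]

theorem wedgeMatrix_eq_zero_of_not_linearIndependent {x y : Fin n → F}
    (h : ¬ LinearIndependent F ![x, y]) : wedgeMatrix F n x y = 0 := by
  by_cases hx : x = 0
  · simp [hx]
  · rw [LinearIndependent.pair_iff' hx] at h
    push Not at h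
    obtain ⟨a, rfl⟩ := h
    simp [wedgeMatrix_self]

theorem alternatingMatrices_le_of_wedgeMatrix_mem {U : Submodule F (Matrix (Fin n) (Fin n) F)}
    (h : ∀ x y, wedgeMatrix F n x y ∈ U) : alternatingMatrices F n ≤ U := by
  rintro A ⟨hA, hdiag⟩
  have hsum : A = ∑ i, ∑ j, (if i < j then A i j else 0) •
      wedgeMatrix F n (Pi.single i 1) (Pi.single j 1) := by
    ext k l
    have hkl : A l k = -A k l := congrFun (congrFun hA k) l
    simp only [wedgeMatrix_apply, Matrix.sum_apply, Matrix.smul_apply, Matrix.sub_apply,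
      vecMulVec_apply, Pi.single_apply, smul_eq_mul, mul_sub, Finset.sum_sub_distrib]
    simp only [mul_ite, mul_one, mul_zero]
    rcases lt_trichotomy k l with hlt | rfl | hlt
    · simp [Finset.sum_ite_eq, hlt, hlt.not_gt]
    · simp [hdiag]
    · simp [Finset.sum_ite_eq, hlt, hlt.not_gt, hkl]
  rw [hsum]
  exact U.sum_mem fun i _ => U.sum_mem fun j _ => U.smul_mem _ (h _ _)

theorem finrank_alternatingMatrices :
    Module.finrank F (alternatingMatrices F n) = n * (n - 1) / 2 := by
  let L : alternatingMatrices F n →ₗ[F] ((Σ j : Fin n, Fin j) → F) :=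
    { toFun := fun A p => A.1 (p.2.castLE p.1.2.le) p.1
      map_add' := fun _ _ => rfl
      map_smul' := fun _ _ => rfl }
  have hinj : Function.Injective L := by
    rw [injective_iff_map_eq_zero]
    rintro ⟨A, hA, hdiag⟩ h
    have hlt (i j : Fin n) (hij : i < j) : A i j = 0 := congrFun h ⟨j, ⟨i, hij⟩⟩
    ext i j
    rcases lt_trichotomy i j with hij | rfl | hij
    · exact hlt i j hij
    · exact hdiag i
    · have : A i j = -A j i := congrFun (congrFun hA j) i
      simp [this, hlt j i hij]
  have hsurj : Function.Surjective L := by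
    intro g
    refine ⟨⟨of fun i j => if h : i < j then g ⟨j, ⟨i, h⟩⟩ else
      if h : j < i then -g ⟨i, ⟨j, h⟩⟩ else 0, ?_, ?_⟩, ?_⟩
    · ext i j
      rcases lt_trichotomy i j with hij | rfl | hij
      · simp [hij, hij.not_gt]
      · simp
      · simp [hij, hij.not_gt]
    · simp
    · ext ⟨j, i⟩
      exact dif_pos (show i.castLE j.2.le < j from i.2)
  rw [(LinearEquiv.ofBijective L ⟨hinj, hsurj⟩).finrank_eq, Module.finrank_fintype_fun_eq_card,
    Fintype.card_sigma]
  simp only [Fintype.card_fin]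
  rw [Fin.sum_univ_eq_sum_range (fun i => i), Finset.sum_range_id]

end Alternating

theorem exists_dotProduct_eq {F : Type*} [Field F] {n : ℕ} {x y : Fin n → F}
    (h : LinearIndependent F ![x, y]) (a b : F) :
    ∃ v : Fin n → F, x ⬝ᵥ v = a ∧ y ⬝ᵥ v = b := by
  obtain ⟨g, hg⟩ := LinearMap.exists_extend ((Module.Basis.span h).constr F ![a, b])
  have key (i : Fin 2) : g (![x, y] i) = ![a, b] i := by
    have := LinearMap.congr_fun hg (Module.Basis.span h i)
    rwa [Module.Basis.constr_basis, LinearMap.comp_apply, Submodule.subtype_apply,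
      Module.Basis.span_apply] at this
  have hdot (z : Fin n → F) : z ⬝ᵥ (fun i => g (Pi.single i 1)) = g z := by
    conv_rhs => rw [pi_eq_sum_univ' z]
    simp [dotProduct]
  exact ⟨_, (hdot x).trans (key 0), (hdot y).trans (key 1)⟩

/-- Theorem 3.6, non-alternating case: if `φ` is non-degenerate, trace-valued,
not alternating and of Witt index at least 2, then the matrices
`xyᵀ − yxᵀ` for `⟨x,y⟩` totally isotropic span the whole space of alternating
`n×n` matrices, which has dimension `n(n−1)/2`. -/
theorem stmt_5 (F : Type*) [Field F] (n : ℕ) (hn : 4 ≤ n)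
    (σ : F ≃+* F) (hσ : ∀ t, σ (σ t) = t)
    (ε : F) (hε : σ ε * ε = 1)
    (Φ : Matrix (Fin n) (Fin n) F) (hΦ : Φᵀ = ε • Φ.map σ)
    (hΦunit : IsUnit Φ)
    (φ : (Fin n → F) → (Fin n → F) → F)
    (hφ : ∀ a b, φ a b = (fun i => σ (a i)) ⬝ᵥ (Φ *ᵥ b))
    (htrace : ∀ x : Fin n → F, ∃ t : F, φ x x = t + ε * σ t)
    (hnonalt : ∃ x : Fin n → F, φ x x ≠ 0)
    (hWitt : ∃ x y : Fin n → F, LinearIndependent F ![x, y] ∧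
      ∀ s ∈ Submodule.span F {x, y}, ∀ t ∈ Submodule.span F {x, y}, φ s t = 0) :
    (Submodule.span F
      {A : Matrix (Fin n) (Fin n) F | ∃ x y : Fin n → F,
        LinearIndependent F ![x, y] ∧
        (∀ s ∈ Submodule.span F {x, y}, ∀ t ∈ Submodule.span F {x, y}, φ s t = 0) ∧
        A = vecMulVec x y - vecMulVec y x} :
      Set (Matrix (Fin n) (Fin n) F)) =
      {A : Matrix (Fin n) (Fin n) F | Aᵀ = -A ∧ ∀ i, A i i = 0} ∧
    Module.finrank F (Submodule.span F
      {A : Matrix (Fin n) (Fin n) F | ∃ x y : Fin n → F,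
        LinearIndependent F ![x, y] ∧
        (∀ s ∈ Submodule.span F {x, y}, ∀ t ∈ Submodule.span F {x, y}, φ s t = 0) ∧
        A = vecMulVec x y - vecMulVec y x}) = n * (n - 1) / 2 := by
  let ψ : (Fin n → F) →ₛₗ[(σ : F →+* F)] (Fin n → F) →ₗ[F] F :=
    LinearMap.mk₂'ₛₗ _ _ φ
      (fun x y z => by
        simp only [hφ, Pi.add_apply, map_add, ← add_dotProduct]; rfl)
      (fun c x y => by
        simp only [hφ, Pi.smul_apply, smul_eq_mul, map_mul, RingHom.coe_coe,
          dotProduct, Finset.mul_sum, mul_assoc])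
      (fun x y z => by simp only [hφ, mulVec_add, dotProduct_add])
      (fun c x y => by simp only [hφ, mulVec_smul, dotProduct_smul, RingHom.id_apply])
  have hψ (x y) : ψ x y = φ x y := rfl
  have hsymm (x y) : ψ y x = ε * σ (ψ x y) := by
    have hentry (i j) : Φ j i = ε * σ (Φ i j) := congrFun (congrFun hΦ i) j
    simp only [hψ, hφ, dotProduct, mulVec, map_sum, map_mul, hσ, Finset.mul_sum]
    rw [Finset.sum_comm]
    refine Finset.sum_congr rfl fun i _ => Finset.sum_congr rfl fun j _ => ?_
    rw [hentry i j]
    ring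
  have hsolve {x y : Fin n → F} (h : LinearIndependent F ![x, y]) (a b : F) :
      ∃ z, ψ x z = a ∧ ψ y z = b := by
    obtain ⟨v, hx, hy⟩ := exists_dotProduct_eq h (σ a) (σ b)
    have hz (u : Fin n → F) : ψ u (Φ⁻¹ *ᵥ fun i => σ (v i)) = σ (u ⬝ᵥ v) := by
      rw [hψ, hφ, mulVec_mulVec, mul_nonsing_inv _ ((isUnit_iff_isUnit_det _).1 hΦunit),
        one_mulVec]
      simp [dotProduct]
    exact ⟨_, by rw [hz, hx, hσ], by rw [hz, hy, hσ]⟩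
  set S := {A : Matrix (Fin n) (Fin n) F | ∃ x y : Fin n → F,
        LinearIndependent F ![x, y] ∧
        (∀ s ∈ Submodule.span F {x, y}, ∀ t ∈ Submodule.span F {x, y}, φ s t = 0) ∧
        A = vecMulVec x y - vecMulVec y x}
  have hpair (x y : Fin n → F) (hx : ψ x x = 0) (hy : ψ y y = 0) (hxy : ψ x y = 0) :
      (wedgeMatrix F n).compr₂ (Submodule.span F S).mkQ x y = 0 := by
    simp only [LinearMap.compr₂_apply, Submodule.mkQ_apply, Submodule.Quotient.mk_eq_zero]
    by_cases hind : LinearIndependent F ![x, y]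
    · refine Submodule.subset_span ⟨x, y, hind, fun s hs t ht => ?_, rfl⟩
      obtain ⟨a, b, rfl⟩ := Submodule.mem_span_pair.1 hs
      obtain ⟨c, d, rfl⟩ := Submodule.mem_span_pair.1 ht
      rw [← hψ]
      simp [hx, hy, hxy, swap_eq_zero hsymm hxy]
    · rw [wedgeMatrix_eq_zero_of_not_linearIndependent hind]
      exact zero_mem _
  have hspan : Submodule.span F S = alternatingMatrices F n := by
    refine le_antisymm (Submodule.span_le.2 ?_) (alternatingMatrices_le_of_wedgeMatrix_mem ?_)
    · rintro _ ⟨x, y, -, -, rfl⟩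
      exact wedgeMatrix_mem_alternatingMatrices x y
    · intro x y
      obtain ⟨e₁, e₂, hind, hiso⟩ := hWitt
      have m₁ : e₁ ∈ Submodule.span F {e₁, e₂} := Submodule.subset_span (by simp)
      have m₂ : e₂ ∈ Submodule.span F {e₁, e₂} := Submodule.subset_span (by simp)
      have h₁₁ : ψ e₁ e₁ = 0 := hiso _ m₁ _ m₁
      have h₁₂ : ψ e₁ e₂ = 0 := hiso _ m₁ _ m₂
      have h₂₂ : ψ e₂ e₂ = 0 := hiso _ m₂ _ m₂
      obtain ⟨f₁, f₂, k₁, k₂, k₃, k₄, k₅, k₆, k₇⟩ := exists_hyperbolic_frame hσ hε hsymm htrace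
        h₁₁ h₁₂ h₂₂ (hsolve hind 1 0) (hsolve hind 0 1)
      have h := eq_zero_of_vanish_on_isotropic_pairs hε hsymm htrace hnonalt
        (B := (wedgeMatrix F n).compr₂ (Submodule.span F S).mkQ)
        (fun x => by simp [wedgeMatrix_self]) hpair h₁₁ h₂₂ k₁ k₂ h₁₂ k₃ k₄ k₅ k₆ k₇ x y
      simpa using h
  rw [hspan]
  exact ⟨rfl, finrank_alternatingMatrices⟩
end

section
/- Let F be a field, n ≥ 4, and let Φ be a nonzero n×n matrix over F with Φᵀ = −Φ and all diagonal entries 0, so that the bilinear form φ(x,y) = xᵀ·Φ·y on Fⁿ is alternating (φ(x,x) = 0 for all x); φ may be degenerate. Assume there exist linearly independent x, y ∈ Fⁿ whose span is totally isotropic for φ. Then the F-linear span of the set of matrices {x·yᵀ − y·xᵀ : x, y ∈ Fⁿ linearly independent and span{x,y} totally isotropic for φ} has dimension exactly n(n−1)/2 − 1; that is, it is a hyperplane of the space of alternating n×n matrices {A : Aᵀ = −A and all diagonal entries of A are 0}. -/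
open Matrix

section BilinearIntoModule

variable {F E V : Type*} [Field F] [AddCommGroup E] [Module F E] [AddCommGroup V] [Module F V]

/-- If `φ x y = 0` forces `B x y = 0`, then `B x y` is proportional to `φ x y` for fixed `x`. -/
lemma LinearMap.smul_apply_eq_of_forall_apply_eq_zero (φ : E →ₗ[F] E →ₗ[F] F)
    (B : E →ₗ[F] E →ₗ[F] V) (h : ∀ x y, φ x y = 0 → B x y = 0) (x y z : E) :
    φ x z • B x y = φ x y • B x z := by
  have := h x (φ x z • y - φ x y • z) (by simp [mul_comm])
  simpa [sub_eq_zero] using this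

/-- An alternating bilinear map vanishing on all orthogonal pairs of an alternating form `φ` is
a multiple of `φ`. -/
lemma LinearMap.smul_apply_eq_smul_apply_of_isAlt (φ : E →ₗ[F] E →ₗ[F] F)
    (B : E →ₗ[F] E →ₗ[F] V) (hφ : ∀ x y, φ x y = -φ y x) (hB : ∀ x y, B x y = -B y x)
    (h : ∀ x y, φ x y = 0 → B x y = 0) (a b x y : E) (hab : φ a b ≠ 0) :
    B x y = (φ x y / φ a b) • B a b := by
  by_cases hxy : φ x y = 0
  · simp [hxy, h x y hxy]
  have key := LinearMap.smul_apply_eq_of_forall_apply_eq_zero φ B h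
  have key' (x y z : E) : φ z x • B y x = φ y x • B z x := by
    have := key x y z
    rw [hφ x z, hφ x y, hB x y, hB x z] at this
    simpa using this
  obtain ⟨z, hxz, haz⟩ : ∃ z, φ x z ≠ 0 ∧ φ a z ≠ 0 := by
    by_cases hxb : φ x b = 0
    · by_cases hay : φ a y = 0
      · exact ⟨y + b, by simp [hxb, hxy], by simp [hay, hab]⟩
      · exact ⟨y, hxy, hay⟩
    · exact ⟨b, hxb, hab⟩
  have e1 : B x y = (φ x y / φ x z) • B x z := by
    rw [div_eq_inv_mul, mul_smul, ← key, inv_smul_smul₀ hxz]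
  have e2 : B x z = (φ x z / φ a z) • B a z := by
    rw [div_eq_inv_mul, mul_smul, ← key', inv_smul_smul₀ haz]
  have e3 : B a z = (φ a z / φ a b) • B a b := by
    rw [div_eq_inv_mul, mul_smul, ← key, inv_smul_smul₀ hab]
  rw [e1, e2, e3, smul_smul, smul_smul]
  congr 1
  field_simp

end BilinearIntoModule

/-- A double sum with vanishing diagonal is a sum over the pairs `i < j`. -/
lemma Finset.sum_sum_eq_sum_sum_lt {ι M : Type*} [Fintype ι] [LinearOrder ι] [AddCommMonoid M]
    (f : ι → ι → M) (hf : ∀ i, f i i = 0) :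
    ∑ i, ∑ j, f i j = ∑ i, ∑ j, if i < j then f i j + f j i else 0 := by
  have h1 : ∀ i j, f i j = (if i < j then f i j else 0) + (if j < i then f i j else 0) := by
    intro i j
    rcases lt_trichotomy i j with h | rfl | h
    · simp [h, h.not_gt]
    · simp [hf]
    · simp [h, h.not_gt]
  have h2 : ∀ i j, (if i < j then f i j + f j i else 0) =
      (if i < j then f i j else 0) + (if i < j then f j i else 0) := by
    intro i j
    split_ifs <;> simp
  simp_rw [h2, Finset.sum_add_distrib]
  rw [Finset.sum_comm (f := fun i j => if i < j then f j i else 0)]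
  simp_rw [← Finset.sum_add_distrib, ← h1]

namespace Matrix

section Alternating

variable (F : Type*) [Field F] (n : ℕ)

/-- The space of alternating matrices. -/
def alternatingSubmodule : Submodule F (Matrix (Fin n) (Fin n) F) where
  carrier := {A | Aᵀ = -A ∧ ∀ i, A i i = 0}
  add_mem' := by
    rintro A B ⟨hA, hA'⟩ ⟨hB, hB'⟩
    exact ⟨by rw [transpose_add, hA, hB, neg_add], fun i => by simp [hA', hB']⟩
  zero_mem' := by simp
  smul_mem' := by
    rintro c A ⟨hA, hA'⟩
    exact ⟨by rw [transpose_smul, hA, smul_neg], fun i => by simp [hA']⟩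

variable {F n}

lemma apply_swap_of_mem_alternatingSubmodule {A : Matrix (Fin n) (Fin n) F}
    (hA : A ∈ alternatingSubmodule F n) (i j : Fin n) : A j i = -A i j :=
  congrFun (congrFun hA.1 i) j

variable (F n)

/-- An alternating matrix is determined by its entries above the diagonal. -/
def alternatingSubmoduleEquiv :
    alternatingSubmodule F n ≃ₗ[F] ({p : Fin n × Fin n // p.1 < p.2} → F) where
  toFun A p := A.1 p.1.1 p.1.2
  map_add' _ _ := rfl
  map_smul' _ _ := rfl
  invFun f := ⟨of fun i j => if h : i < j then f ⟨(i, j), h⟩ else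
      if h : j < i then -f ⟨(j, i), h⟩ else 0, by
    refine ⟨?_, fun i => by simp⟩
    ext i j
    rcases lt_trichotomy i j with h | rfl | h
    · simp [h, h.not_gt]
    · simp
    · simp [h, h.not_gt]⟩
  left_inv A := by
    ext i j
    rcases lt_trichotomy i j with h | rfl | h
    · simp [h]
    · simp [A.2.2]
    · simp [h, h.not_gt, apply_swap_of_mem_alternatingSubmodule A.2 j i]
  right_inv f := by
    ext ⟨⟨i, j⟩, h⟩
    have h' : i < j := h
    simp [h']

lemma finrank_alternatingSubmodule :
    Module.finrank F (alternatingSubmodule F n) = n * (n - 1) / 2 := by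
  rw [(alternatingSubmoduleEquiv F n).finrank_eq, Module.finrank_fintype_fun_eq_card,
    Fintype.card_subtype, Finset.card_filter, Fintype.sum_prod_type_right,
    ← Finset.sum_range_id_mul_two, Nat.mul_div_cancel _ two_pos, ← Fin.sum_univ_eq_sum_range]
  refine Finset.sum_congr rfl fun j _ => ?_
  rw [← Finset.card_filter, Finset.filter_gt_eq_Iio, Fin.card_Iio]

variable {F n}

/-- The bilinear map `(x, y) ↦ x yᵀ - y xᵀ`. -/
def wedge : (Fin n → F) →ₗ[F] (Fin n → F) →ₗ[F] Matrix (Fin n) (Fin n) F :=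
  vecMulVecBilin F F - (vecMulVecBilin F F).flip

lemma wedge_apply (x y : Fin n → F) : wedge x y = vecMulVec x y - vecMulVec y x := rfl

lemma wedge_swap (x y : Fin n → F) : wedge x y = -wedge y x := by
  simp [wedge_apply]

lemma wedge_mem_alternatingSubmodule (x y : Fin n → F) :
    wedge x y ∈ alternatingSubmodule F n := by
  refine ⟨?_, fun i => ?_⟩
  · simp [wedge_apply, transpose_vecMulVec]
  · simp [wedge_apply, vecMulVec_apply, mul_comm]

lemma alternatingSubmodule_le_of_wedge_mem (S : Submodule F (Matrix (Fin n) (Fin n) F))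
    (hS : ∀ x y, wedge x y ∈ S) : alternatingSubmodule F n ≤ S := by
  intro A hA
  rw [matrix_eq_sum_single A, Finset.sum_sum_eq_sum_sum_lt _ (by simp [hA.2])]
  refine Submodule.sum_mem _ fun i _ => Submodule.sum_mem _ fun j _ => ?_
  split_ifs
  · convert S.smul_mem (A i j) (hS (Pi.single i 1) (Pi.single j 1)) using 1
    rw [wedge_apply, apply_swap_of_mem_alternatingSubmodule hA i j]
    ext k l
    simp only [single, add_apply, of_apply, smul_apply, sub_apply, vecMulVec_apply,
      Pi.single_apply, smul_eq_mul]
    grind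
  · exact S.zero_mem

/-- The linear functional with `x yᵀ - y xᵀ ↦ xᵀ Φ y`, for `Φ` alternating. -/
def alternatingPairing (Φ : Matrix (Fin n) (Fin n) F) : Matrix (Fin n) (Fin n) F →ₗ[F] F :=
  ∑ i, ∑ j, if i < j then Φ i j • entryLinearMap F F i j else 0

lemma alternatingPairing_wedge {Φ : Matrix (Fin n) (Fin n) F}
    (hΦ : Φ ∈ alternatingSubmodule F n) (x y : Fin n → F) :
    alternatingPairing Φ (wedge x y) = x ⬝ᵥ (Φ *ᵥ y) := by
  have : x ⬝ᵥ (Φ *ᵥ y) = ∑ i, ∑ j, x i * Φ i j * y j := by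
    simp [dotProduct, mulVec, Finset.mul_sum, mul_assoc]
  rw [this, Finset.sum_sum_eq_sum_sum_lt _ (by simp [hΦ.2]), alternatingPairing]
  simp only [LinearMap.sum_apply]
  refine Finset.sum_congr rfl fun i _ => Finset.sum_congr rfl fun j _ => ?_
  split_ifs
  · simp only [LinearMap.smul_apply, entryLinearMap_apply, wedge_apply, sub_apply,
      vecMulVec_apply, smul_eq_mul, apply_swap_of_mem_alternatingSubmodule hΦ i j]
    ring
  · simp

lemma wedge_eq_zero_of_not_linearIndependent {x y : Fin n → F}
    (h : ¬ LinearIndependent F ![x, y]) : wedge x y = 0 := by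
  have hself (z : Fin n → F) : wedge z z = 0 := by simp [wedge_apply]
  rw [LinearIndependent.pair_iff] at h
  push Not at h
  obtain ⟨s, t, hst, hne⟩ := h
  by_cases hs : s = 0
  · have : wedge x (s • x + t • y) = 0 := by rw [hst, map_zero]
    simpa [hself, hs, hne hs] using this
  · have : wedge (s • x + t • y) y = 0 := by rw [hst, map_zero, LinearMap.zero_apply]
    simpa [hself, hs] using this

lemma dotProduct_mulVec_eq_zero_of_mem_span_pair {Φ : Matrix (Fin n) (Fin n) F}
    (hΦ : Φ ∈ alternatingSubmodule F n) {x y s t : Fin n → F} (hxy : x ⬝ᵥ (Φ *ᵥ y) = 0)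
    (hs : s ∈ Submodule.span F {x, y}) (ht : t ∈ Submodule.span F {x, y}) :
    s ⬝ᵥ (Φ *ᵥ t) = 0 := by
  obtain ⟨a, b, rfl⟩ := Submodule.mem_span_pair.1 hs
  obtain ⟨c, d, rfl⟩ := Submodule.mem_span_pair.1 ht
  have hself (z : Fin n → F) : wedge z z = 0 := by simp [wedge_apply]
  rw [← alternatingPairing_wedge hΦ] at hxy ⊢
  simp [hself, wedge_swap y x, hxy]

end Alternating

end Matrix

/-- Theorem 3.6, alternating case: for a nonzero (possibly degenerate)
alternating form `φ` of Witt index at least 2, the matrices `xyᵀ − yxᵀ` for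
`⟨x,y⟩` totally isotropic span a hyperplane of the space of alternating
`n×n` matrices, i.e. a subspace of dimension `n(n−1)/2 − 1`. -/
theorem stmt_6 (F : Type*) [Field F] (n : ℕ) (hn : 4 ≤ n)
    (Φ : Matrix (Fin n) (Fin n) F) (hΦ0 : Φ ≠ 0)
    (hΦT : Φᵀ = -Φ) (hΦdiag : ∀ i, Φ i i = 0)
    (φ : (Fin n → F) → (Fin n → F) → F)
    (hφ : ∀ a b, φ a b = a ⬝ᵥ (Φ *ᵥ b))
    (hWitt : ∃ x y : Fin n → F, LinearIndependent F ![x, y] ∧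
      ∀ s ∈ Submodule.span F {x, y}, ∀ t ∈ Submodule.span F {x, y}, φ s t = 0) :
    Module.finrank F (Submodule.span F
      {A : Matrix (Fin n) (Fin n) F | ∃ x y : Fin n → F,
        LinearIndependent F ![x, y] ∧
        (∀ s ∈ Submodule.span F {x, y}, ∀ t ∈ Submodule.span F {x, y}, φ s t = 0) ∧
        A = vecMulVec x y - vecMulVec y x}) = n * (n - 1) / 2 - 1 := by
  set S := Submodule.span F {A : Matrix (Fin n) (Fin n) F | ∃ x y : Fin n → F,
    LinearIndependent F ![x, y] ∧
    (∀ s ∈ Submodule.span F {x, y}, ∀ t ∈ Submodule.span F {x, y}, φ s t = 0) ∧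
    A = vecMulVec x y - vecMulVec y x} with hS
  have hΦ : Φ ∈ alternatingSubmodule F n := ⟨hΦT, hΦdiag⟩
  have hpair (x y : Fin n → F) : alternatingPairing Φ (wedge x y) = φ x y :=
    (alternatingPairing_wedge hΦ x y).trans (hφ x y).symm
  obtain ⟨a, b, hab⟩ : ∃ a b, φ a b ≠ 0 := by
    by_contra! h
    refine hΦ0 (ext fun i j => ?_)
    simpa [hφ] using h (Pi.single i 1) (Pi.single j 1)
  have hmem (x y : Fin n → F) (hxy : φ x y = 0) : wedge x y ∈ S := by
    by_cases hli : LinearIndependent F ![x, y]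
    · refine Submodule.subset_span ⟨x, y, hli, fun s hs t ht => ?_, rfl⟩
      rw [hφ] at hxy ⊢
      exact dotProduct_mulVec_eq_zero_of_mem_span_pair hΦ hxy hs ht
    · rw [wedge_eq_zero_of_not_linearIndependent hli]
      exact S.zero_mem
  have hker : S ≤ LinearMap.ker (alternatingPairing Φ) := by
    rw [hS, Submodule.span_le]
    rintro _ ⟨x, y, -, hiso, rfl⟩
    rw [← wedge_apply, SetLike.mem_coe, LinearMap.mem_ker, hpair]
    exact hiso x (Submodule.subset_span (by simp)) y (Submodule.subset_span (by simp))
  have hnot : wedge a b ∉ S := fun h => hab (by simpa [hpair] using hker h)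
  have hsup : S ⊔ Submodule.span F {wedge a b} = alternatingSubmodule F n := by
    refine le_antisymm (sup_le (Submodule.span_le.2 ?_) (Submodule.span_le.2 ?_))
      (alternatingSubmodule_le_of_wedge_mem _ fun x y => ?_)
    · rintro _ ⟨x, y, -, -, rfl⟩
      exact wedge_mem_alternatingSubmodule x y
    · simpa using wedge_mem_alternatingSubmodule a b
    · have h := LinearMap.smul_apply_eq_smul_apply_of_isAlt
        (wedge.compr₂ (alternatingPairing Φ)) (wedge.compr₂ S.mkQ)
        (fun x y => by simp [wedge_swap x y]) (fun x y => by simp [wedge_swap x y])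
        (fun x y h => by simpa using hmem x y (by simpa [hpair] using h))
        a b x y (by simpa [hpair] using hab)
      simp only [LinearMap.compr₂_apply, ← map_smul S.mkQ] at h
      rw [Submodule.mkQ_apply, Submodule.mkQ_apply, Submodule.Quotient.eq] at h
      rw [← sub_add_cancel (wedge x y)]
      exact Submodule.add_mem_sup h
        (Submodule.smul_mem _ _ (Submodule.mem_span_singleton_self _))
  have hfin := Submodule.finrank_sup_span_singleton hnot
  rw [hsup, finrank_alternatingSubmodule] at hfin
  omega
end

section
/- Let F be a field of characteristic 2, n ≥ 4, and let χ be a quadratic form on Fⁿ which is non-singular and has Witt index at least 2. Let x, y ∈ Fⁿ be linearly independent and set X = x·yᵀ − y·xᵀ. Then the span of x and y is totally singular for χ if and only if both of the following hold: (i) Φ·X·Φ·X = 0, and (ii) for every k ∈ {1, …, n}, χ applied to the k-th column of X equals 0. -/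
open Matrix

/-- The Gram matrix of the polar form of `χ` computes the polar form. -/
theorem QuadraticMap.dotProduct_gram_mulVec_eq_polar {R : Type*} [CommRing R] {n : ℕ}
    (χ : QuadraticForm R (Fin n → R)) (u v : Fin n → R) :
    u ⬝ᵥ ((Matrix.of fun i j =>
      QuadraticMap.polar χ (Pi.single i 1) (Pi.single j 1)) *ᵥ v) = QuadraticMap.polar χ u v := by
  have h : (Matrix.of fun i j => QuadraticMap.polar χ (Pi.single i 1) (Pi.single j 1)) =
      LinearMap.toMatrix₂' R χ.polarBilin := by
    ext i j
    simp [LinearMap.toMatrix₂'_apply]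
  rw [h, ← Matrix.toLinearMap₂'_apply', Matrix.toLinearMap₂'_toMatrix']
  rfl

/-- Two linearly independent vectors have a nonzero `2 × 2` minor. -/
theorem LinearIndependent.exists_minor_ne_zero {F ι : Type*} [Field F] {x y : ι → F}
    (hxy : LinearIndependent F ![x, y]) : ∃ i j, x i * y j - y i * x j ≠ 0 := by
  by_contra! h
  have hx : x ≠ 0 := hxy.ne_zero 0
  obtain ⟨i, hi⟩ := Function.ne_iff.mp hx
  refine hi (LinearIndependent.pair_iff.mp hxy (-y i) (x i) ?_).2
  ext j
  simp only [Pi.add_apply, Pi.smul_apply, smul_eq_mul, Pi.zero_apply]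
  linear_combination h i j

/-- Values of a quadratic form on linear combinations of two vectors. -/
theorem QuadraticMap.map_smul_add_smul {R M : Type*} [CommRing R] [AddCommGroup M] [Module R M]
    (χ : QuadraticForm R M) (a b : R) (x y : M) :
    χ (a • x + b • y) = a * a * χ x + b * b * χ y + a * b * QuadraticMap.polar χ x y := by
  rw [QuadraticMap.map_add χ, QuadraticMap.map_smul, QuadraticMap.map_smul,
    QuadraticMap.polar_smul_left, QuadraticMap.polar_smul_right]
  simp only [smul_eq_mul]
  ring

/-- The plane spanned by `x` and `y` is totally singular iff `χ` vanishes at `x` and `y` and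
these are orthogonal. -/
theorem QuadraticMap.forall_mem_span_pair_eq_zero_iff {R M : Type*} [CommRing R]
    [AddCommGroup M] [Module R M] (χ : QuadraticForm R M) (x y : M) :
    (∀ v ∈ Submodule.span R {x, y}, χ v = 0) ↔
      χ x = 0 ∧ χ y = 0 ∧ QuadraticMap.polar χ x y = 0 := by
  constructor
  · intro h
    have hx : x ∈ Submodule.span R {x, y} := Submodule.subset_span (by simp)
    have hy : y ∈ Submodule.span R {x, y} := Submodule.subset_span (by simp)
    refine ⟨h x hx, h y hy, ?_⟩
    rw [QuadraticMap.polar, h _ (add_mem hx hy), h x hx, h y hy]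
    simp
  · rintro ⟨hx, hy, h⟩ v hv
    obtain ⟨a, b, rfl⟩ := Submodule.mem_span_pair.mp hv
    rw [QuadraticMap.map_smul_add_smul, hx, hy, h]
    simp

/-- Theorem 3.7: in characteristic 2, for a non-singular quadratic form `χ`
of Witt index at least 2 and `X = xyᵀ − yxᵀ`, the span of `x, y` is totally
singular for `χ` iff `Φ X Φ X = O` and `χ` vanishes on every column of `X`,
where `Φ` is the Gram matrix of the polar form of `χ`. -/
theorem stmt_7 (F : Type*) [Field F] [CharP F 2] (n : ℕ) (hn : 4 ≤ n)
    (χ : QuadraticForm F (Fin n → F))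
    (hns : ∀ w : Fin n → F, w ≠ 0 →
      (∀ z : Fin n → F, QuadraticMap.polar χ w z = 0) → χ w ≠ 0)
    (hWitt : ∃ a b : Fin n → F, LinearIndependent F ![a, b] ∧
      ∀ v ∈ Submodule.span F {a, b}, χ v = 0)
    (Φ : Matrix (Fin n) (Fin n) F)
    (hΦ : Φ = Matrix.of fun i j =>
      QuadraticMap.polar χ (Pi.single i 1) (Pi.single j 1))
    (x y : Fin n → F)
    (hxy : LinearIndependent F ![x, y])
    (X : Matrix (Fin n) (Fin n) F)
    (hX : X = vecMulVec x y - vecMulVec y x) :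
    (∀ v ∈ Submodule.span F {x, y}, χ v = 0) ↔
      (Φ * X * Φ * X = 0 ∧ ∀ k : Fin n, χ (fun i => X i k) = 0) := by
  subst hX
  have hpol (u v : Fin n → F) : u ⬝ᵥ (Φ *ᵥ v) = QuadraticMap.polar χ u v := by
    rw [hΦ, QuadraticMap.dotProduct_gram_mulVec_eq_polar]
  have hself (u : Fin n → F) : QuadraticMap.polar χ u u = 0 := by
    rw [QuadraticMap.polar_self, CharTwo.two_nsmul]
  obtain ⟨i, j, hij⟩ := hxy.exists_minor_ne_zero
  set X := vecMulVec x y - vecMulVec y x with hX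
  have hXX : X * (Φ * X) = QuadraticMap.polar χ x y • X := by
    simp only [hX, mul_sub, sub_mul, Matrix.mul_vecMulVec, Matrix.vecMulVec_mulVec, hpol,
      hself, QuadraticMap.polar_comm χ y x]
    ext k l
    simp only [Matrix.sub_apply, Matrix.smul_apply, vecMulVec_apply, Pi.smul_apply, smul_eq_mul,
      MulOpposite.smul_eq_mul_unop, MulOpposite.unop_op, CharTwo.sub_eq_add]
    ring
  have hcol (k : Fin n) : χ (fun i => X i k) =
      y k * y k * χ x + x k * x k * χ y + y k * x k * QuadraticMap.polar χ x y := by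
    have h : (fun i => X i k) = y k • x + x k • y := by
      ext l
      simp [hX, vecMulVec_apply, CharTwo.sub_eq_add, mul_comm]
    rw [h, QuadraticMap.map_smul_add_smul]
  have hquad : Φ * X * Φ * X = QuadraticMap.polar χ x y • (Φ * X) := by
    rw [Matrix.mul_assoc (Φ * X), Matrix.mul_assoc Φ, hXX, Matrix.mul_smul]
  rw [QuadraticMap.forall_mem_span_pair_eq_zero_iff, hquad]
  constructor
  · rintro ⟨hx, hy, h⟩
    exact ⟨by rw [h, zero_smul], fun k => by rw [hcol, hx, hy, h]; ring⟩
  · rintro ⟨h₁, h₂⟩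
    have h : QuadraticMap.polar χ x y = 0 := by
      rcases smul_eq_zero.mp h₁ with h | h
      · exact h
      · rw [h, Matrix.mul_zero] at hXX
        refine (smul_eq_zero.mp hXX.symm).resolve_right fun h0 => hij ?_
        simpa [hX, vecMulVec_apply] using congr_fun₂ h0 i j
    have hi := h₂ i
    have hj := h₂ j
    rw [hcol, h] at hi hj
    have h2 : (2 : F) = 0 := CharTwo.two_eq_zero
    have hsq := mul_ne_zero hij hij
    refine ⟨(mul_eq_zero.mp ?_).resolve_left hsq, (mul_eq_zero.mp ?_).resolve_left hsq, h⟩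
    · linear_combination x i * x i * hj + x j * x j * hi -
        (x i * y j * y i * x j * χ x + x i * x i * x j * x j * χ y) * h2
    · linear_combination y i * y i * hj + y j * y j * hi -
        (x i * y j * y i * x j * χ y + y i * y i * y j * y j * χ x) * h2
end

section
/- Let F be a field of characteristic 2, n ≥ 4, and let χ be a quadratic form on Fⁿ which is non-singular and has Witt index at least 2, with polar form φ. Then the F-linear span of {x·yᵀ − y·xᵀ : x, y ∈ Fⁿ linearly independent and span{x,y} totally singular for χ} is equal to the F-linear span of {x·yᵀ − y·xᵀ : x, y ∈ Fⁿ linearly independent and span{x,y} totally isotropic for φ}. -/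
open Matrix

/-- Two orthogonal vectors on which a quadratic form vanishes span a totally singular subspace. -/
theorem QuadraticMap.eq_zero_of_mem_span_pair {F V : Type*} [Field F] [AddCommGroup V] [Module F V]
    (Q : QuadraticForm F V) {x y : V} (hx : Q x = 0) (hy : Q y = 0)
    (hxy : QuadraticMap.polar Q x y = 0) : ∀ v ∈ Submodule.span F {x, y}, Q v = 0 := by
  intro v hv
  obtain ⟨s, t, rfl⟩ := Submodule.mem_span_pair.1 hv
  simp [QuadraticMap.map_add, QuadraticMap.map_smul, hx, hy, hxy]

/-- A totally singular plane meeting the radical trivially extends to an orthogonal sum of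
two hyperbolic planes. -/
theorem QuadraticMap.exists_two_hyperbolic_pairs {F V : Type*} [Field F] [AddCommGroup V]
    [Module F V] (Q : QuadraticForm F V)
    (hns : ∀ w : V, w ≠ 0 → (∀ z : V, QuadraticMap.polar Q w z = 0) → Q w ≠ 0)
    {a b : V} (hab : LinearIndependent F ![a, b])
    (hQ : ∀ v ∈ Submodule.span F {a, b}, Q v = 0) :
    ∃ e₁ f₁ e₂ f₂ : V, Q e₁ = 0 ∧ Q f₁ = 0 ∧ Q e₂ = 0 ∧ Q f₂ = 0 ∧
      polar Q e₁ f₁ = 1 ∧ polar Q e₂ f₂ = 1 ∧ polar Q e₁ e₂ = 0 ∧ polar Q e₁ f₂ = 0 ∧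
      polar Q f₁ e₂ = 0 ∧ polar Q f₁ f₂ = 0 := by
  have partner : ∀ w : V, w ≠ 0 → Q w = 0 → ∃ z, polar Q w z = 1 := by
    intro w hw hQw
    by_contra! h
    refine hns w hw (fun z => ?_) hQw
    by_contra hz
    exact h ((polar Q w z)⁻¹ • z) (by simp [polar_smul_right, hz])
  have hcomb : ∀ s t : F, Q (s • a + t • b) = 0 := fun s t =>
    hQ _ (Submodule.mem_span_pair.2 ⟨s, t, rfl⟩)
  have ha : Q a = 0 := by simpa using hcomb 1 0
  have hb : Q b = 0 := by simpa using hcomb 0 1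
  have hpab : polar Q a b = 0 := by simpa [QuadraticMap.map_add, ha, hb] using hcomb 1 1
  rw [LinearIndependent.pair_iff] at hab
  have ha0 : a ≠ 0 := by
    rintro rfl
    simpa using hab 1 0 (by simp)
  obtain ⟨z, hz⟩ := partner a ha0 ha
  obtain ⟨c, hc⟩ : ∃ c, c = b - polar Q b z • a := ⟨_, rfl⟩
  have hc0 : c ≠ 0 := by
    rintro rfl
    have := hab (-polar Q b z) 1 (by rw [neg_smul, one_smul, neg_add_eq_sub, ← hc])
    simp at this
  have hQc : Q c = 0 := by
    have := hcomb (-polar Q b z) 1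
    rwa [neg_smul, one_smul, neg_add_eq_sub, ← hc] at this
  have haa : polar Q a a = 0 := by simp [polar_self, ha]
  have hcc : polar Q c c = 0 := by simp [polar_self, hQc]
  have hac : polar Q a c = 0 := by simp [hc, polar_sub_right, polar_smul_right, hpab, haa]
  have hca : polar Q c a = 0 := by rw [polar_comm, hac]
  have hcz : polar Q c z = 0 := by simp [hc, polar_sub_left, polar_smul_left, hz]
  obtain ⟨u, hu⟩ := partner c hc0 hQc
  obtain ⟨f, hf⟩ : ∃ f, f = z - Q z • a := ⟨_, rfl⟩
  have haf : polar Q a f = 1 := by simp [hf, polar_sub_right, polar_smul_right, hz, haa]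
  have hfa : polar Q f a = 1 := by rw [polar_comm, haf]
  have hcf : polar Q c f = 0 := by simp [hf, polar_sub_right, polar_smul_right, hcz, hca]
  have hfc : polar Q f c = 0 := by rw [polar_comm, hcf]
  have hQf : Q f = 0 := by
    simp [hf, sub_eq_add_neg, QuadraticMap.map_add, QuadraticMap.map_smul, ha,
      polar_smul_right, polar_comm Q z a, hz, -neg_smul]
  have hff : polar Q f f = 0 := by simp [polar_self, hQf]
  obtain ⟨g, hg⟩ : ∃ g, g = u - polar Q a u • f - polar Q f u • a := ⟨_, rfl⟩
  have hag : polar Q a g = 0 := by simp [hg, polar_sub_right, polar_smul_right, haf, haa]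
  have hfg : polar Q f g = 0 := by simp [hg, polar_sub_right, polar_smul_right, hff, hfa]
  have hcg : polar Q c g = 1 := by simp [hg, polar_sub_right, polar_smul_right, hcf, hca, hu]
  refine ⟨a, f, c, g - Q g • c, ha, hQf, hQc, ?_, haf, ?_, hac, ?_, hfc, ?_⟩
  · simp [sub_eq_add_neg, QuadraticMap.map_add, QuadraticMap.map_smul, hQc,
      polar_smul_right, polar_comm Q g c, hcg, -neg_smul]
  · simp [polar_sub_right, polar_smul_right, hcg, hcc]
  · simp [polar_sub_right, polar_smul_right, hag, hac]
  · simp [polar_sub_right, polar_smul_right, hfg, hfc]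

/-- In characteristic 2 and in the presence of two orthogonal hyperbolic planes, an alternating map
that vanishes on all orthogonal pairs of singular vectors is a multiple of the polar form. -/
theorem LinearMap.IsAlt.eq_polar_smul {F V N : Type*} [Field F] [CharP F 2] [AddCommGroup V]
    [Module F V] [AddCommGroup N] [Module F N] (Q : QuadraticForm F V)
    {C : V →ₗ[F] V →ₗ[F] N} (hC : C.IsAlt)
    (hsing : ∀ x y, Q x = 0 → Q y = 0 → QuadraticMap.polar Q x y = 0 → C x y = 0)
    {e₁ f₁ e₂ f₂ : V} (he₁ : Q e₁ = 0) (hf₁ : Q f₁ = 0) (he₂ : Q e₂ = 0) (hf₂ : Q f₂ = 0)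
    (h₁ : QuadraticMap.polar Q e₁ f₁ = 1) (h₂ : QuadraticMap.polar Q e₂ f₂ = 1)
    (hee : QuadraticMap.polar Q e₁ e₂ = 0) (hef : QuadraticMap.polar Q e₁ f₂ = 0)
    (hfe : QuadraticMap.polar Q f₁ e₂ = 0) (hff : QuadraticMap.polar Q f₁ f₂ = 0) (x y : V) :
    C x y = QuadraticMap.polar Q x y • C e₁ f₁ := by
  obtain ⟨P, hP⟩ : ∃ P : LinearMap.BilinForm F V, ∀ x y, QuadraticMap.polar Q x y = P x y :=
    ⟨Q.polarBilin, fun _ _ => rfl⟩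
  have hsymm : ∀ x y, P x y = P y x := fun x y => by
    rw [← hP, ← hP, QuadraticMap.polar_comm]
  have hadd : ∀ x y, Q (x + y) = Q x + Q y + P x y := fun x y => by
    rw [QuadraticMap.map_add Q, hP]
  have hself : ∀ x, Q x = 0 → P x x = 0 := fun x hx => by
    rw [← hP, QuadraticMap.polar_self, hx, smul_zero]
  simp only [hP] at *
  have hswap : ∀ x y, C y x = C x y := fun x y => by
    rw [← hC.neg x y, ← neg_one_smul F, CharTwo.neg_eq, one_smul]
  have k₁ : P f₁ e₁ = 1 := by rw [hsymm, h₁]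
  have k₂ : P f₂ e₂ = 1 := by rw [hsymm, h₂]
  have kee : P e₂ e₁ = 0 := by rw [hsymm, hee]
  have kfe : P f₂ e₁ = 0 := by rw [hsymm, hef]
  have kef : P e₂ f₁ = 0 := by rw [hsymm, hfe]
  have kff : P f₂ f₁ = 0 := by rw [hsymm, hff]
  have s₁ := hself _ he₁
  have s₂ := hself _ he₂
  have t₁ := hself _ hf₁
  have t₂ := hself _ hf₂
  have cee := hsing _ _ he₁ he₂ hee
  have cef := hsing _ _ he₁ hf₂ hef
  have cfe := hsing _ _ hf₁ he₂ hfe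
  have cff := hsing _ _ hf₁ hf₂ hff
  have cee' := hsing _ _ he₂ he₁ kee
  have cef' := hsing _ _ he₂ hf₁ kef
  have cfe' := hsing _ _ hf₂ he₁ kfe
  have cff' := hsing _ _ hf₂ hf₁ kff
  have key : C e₂ f₂ = C e₁ f₁ := by
    have := hsing (e₁ + e₂) (f₁ - f₂) (by simp [hadd, he₁, he₂, hee])
      (by simp [sub_eq_add_neg, hadd, hf₁, hf₂, hff])
      (by simp [h₁, h₂, hef, kef])
    simp [cef, cef'] at this
    exact (add_neg_eq_zero.1 this).symm
  have lift₁ : ∀ v w, Q v = 0 → P v e₁ = 0 → P v f₁ = 0 → C v e₁ = 0 → C v f₁ = 0 →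
      P w e₁ = 0 → P w f₁ = 0 → P v w = 0 → C v w = 0 := by
    intro v w hv a b c d p q r
    have := hsing v (w + (e₁ - Q w • f₁)) hv
      (by simp [sub_eq_add_neg, hadd, QuadraticMap.map_smul, he₁, hf₁, p, q, h₁,
        -neg_smul])
      (by simp [a, b, r])
    simpa [c, d] using this
  have lift₂ : ∀ v w, Q v = 0 → P v e₂ = 0 → P v f₂ = 0 → C v e₂ = 0 → C v f₂ = 0 →
      P w e₂ = 0 → P w f₂ = 0 → P v w = 0 → C v w = 0 := by
    intro v w hv a b c d p q r
    have := hsing v (w + (e₂ - Q w • f₂)) hv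
      (by simp [sub_eq_add_neg, hadd, QuadraticMap.map_smul, he₂, hf₂, p, q, h₂,
        -neg_smul])
      (by simp [a, b, r])
    simpa [c, d] using this
  have perp : ∀ w, P e₁ w = 0 → P f₁ w = 0 → P e₂ w = 0 → P f₂ w = 0 →
      C e₁ w = 0 ∧ C f₁ w = 0 ∧ C e₂ w = 0 ∧ C f₂ w = 0 := by
    intro w a b c d
    have a' := (hsymm w e₁).trans a
    have b' := (hsymm w f₁).trans b
    have c' := (hsymm w e₂).trans c
    have d' := (hsymm w f₂).trans d
    exact ⟨lift₂ _ _ he₁ hee hef cee cef c' d' a, lift₂ _ _ hf₁ hfe hff cfe cff c' d' b,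
      lift₁ _ _ he₂ kee kef cee' cef' a' b' c, lift₁ _ _ hf₂ kfe kff cfe' cff' a' b' d⟩
  have perp_perp : ∀ v w, P e₁ v = 0 → P f₁ v = 0 → P e₂ v = 0 → P f₂ v = 0 →
      P e₁ w = 0 → P f₁ w = 0 → P e₂ w = 0 → P f₂ w = 0 → C v w = P v w • C e₁ f₁ := by
    intro v w a b c d a' b' c' d'
    obtain ⟨p, q, r, s⟩ := perp v a b c d
    obtain ⟨p', q', r', s'⟩ := perp w a' b' c' d'
    have := hsing (v + (e₁ - Q v • f₁)) (w + (e₂ - Q w • f₂) - P v w • f₁)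
      (by simp [sub_eq_add_neg, hadd, QuadraticMap.map_smul, he₁, hf₁, hsymm v, a, b,
        h₁, -neg_smul])
      (by simp [sub_eq_add_neg, hadd, QuadraticMap.map_smul, he₂, hf₂, hf₁, hsymm w,
        b', c', d', h₂, kef, kff, -neg_smul])
      (by simp [hsymm v e₂, hsymm v f₂, hsymm v f₁, a', b', b, c, d, h₁, hee, hef, hfe, hff, t₁])
    simp [hswap e₂ v, hswap f₂ v, hswap f₁ v, p', q', q, r, s, cee, cef, cfe, cff, hC f₁] at this
    exact add_neg_eq_zero.1 this
  have decomp : ∀ x, ∃ (s t p q : F) (w : V),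
      x = s • e₁ + t • f₁ + p • e₂ + q • f₂ + w ∧
      P e₁ w = 0 ∧ P f₁ w = 0 ∧ P e₂ w = 0 ∧ P f₂ w = 0 := by
    intro x
    refine ⟨P f₁ x, P e₁ x, P f₂ x, P e₂ x,
      x - (P f₁ x • e₁ + P e₁ x • f₁ + P f₂ x • e₂ + P e₂ x • f₂), by abel, ?_, ?_, ?_, ?_⟩ <;>
    simp [*]
  obtain ⟨s, t, p, q, v, rfl, a, b, c, d⟩ := decomp x
  obtain ⟨s', t', p', q', w, rfl, a', b', c', d'⟩ := decomp y
  obtain ⟨l₁, l₂, l₃, l₄⟩ := perp v a b c d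
  obtain ⟨m₁, m₂, m₃, m₄⟩ := perp w a' b' c' d'
  have hvw := perp_perp v w a b c d a' b' c' d'
  simp only [map_add, map_smul, LinearMap.add_apply, LinearMap.smul_apply, hsymm v e₁, hsymm v f₁,
    hsymm v e₂, hsymm v f₂, a, b, c, d, a', b', c', d', h₁, h₂, k₁, k₂, hee, hef, hfe, hff, kee,
    kef, kfe, kff, s₁, s₂, t₁, t₂, hswap e₁ v, hswap f₁ v, hswap e₂ v, hswap f₂ v, l₁, l₂, l₃, l₄,
    m₁, m₂, m₃, m₄, cee, cef, cfe, cff, cee', cef', cfe', cff', hswap e₁ f₁, hswap e₂ f₂, key,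
    hC e₁, hC e₂, hC f₁, hC f₂, hvw, smul_eq_mul]
  module

/-- The bilinear map `(x, y) ↦ xyᵀ − yxᵀ`. -/
def Matrix.vecMulVecSub (F ι : Type*) [CommRing F] :
    (ι → F) →ₗ[F] (ι → F) →ₗ[F] Matrix ι ι F :=
  LinearMap.mk₂ F (fun x y => vecMulVec x y - vecMulVec y x)
    (fun x y z => by simp only [add_vecMulVec, vecMulVec_add]; abel)
    (fun c x y => by simp only [smul_vecMulVec, vecMulVec_smul, smul_sub])
    (fun x y z => by simp only [add_vecMulVec, vecMulVec_add]; abel)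
    (fun c x y => by simp only [smul_vecMulVec, vecMulVec_smul, smul_sub])

theorem Matrix.vecMulVecSub_apply {F ι : Type*} [CommRing F] (x y : ι → F) :
    vecMulVecSub F ι x y = vecMulVec x y - vecMulVec y x := rfl

theorem Matrix.vecMulVecSub_isAlt {F ι : Type*} [CommRing F] : (vecMulVecSub F ι).IsAlt :=
  fun x => by simp [vecMulVecSub_apply]

/-- The matrix `xyᵀ − yxᵀ` vanishes when `x` and `y` are linearly dependent. -/
theorem Matrix.vecMulVecSub_eq_zero {F ι : Type*} [Field F] {x y : ι → F}
    (h : ¬ LinearIndependent F ![x, y]) : vecMulVecSub F ι x y = 0 := by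
  by_cases hx : x = 0
  · simp [hx]
  · simp only [LinearIndependent.pair_iff' hx, not_forall, not_not] at h
    obtain ⟨c, rfl⟩ := h
    rw [map_smul, vecMulVecSub_isAlt x, smul_zero]

/-- Theorem 3.9: in characteristic 2, for a non-singular quadratic form `χ`
of Witt index at least 2 with polar form `φ`, `⟨𝒢_χ⟩ = ⟨𝒢_φ⟩`: the span of
the matrices `xyᵀ − yxᵀ` over totally singular 2-spaces equals the span over
totally isotropic 2-spaces. -/
theorem stmt_8 (F : Type*) [Field F] [CharP F 2] (n : ℕ) (hn : 4 ≤ n)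
    (χ : QuadraticForm F (Fin n → F))
    (hns : ∀ w : Fin n → F, w ≠ 0 →
      (∀ z : Fin n → F, QuadraticMap.polar χ w z = 0) → χ w ≠ 0)
    (hWitt : ∃ a b : Fin n → F, LinearIndependent F ![a, b] ∧
      ∀ v ∈ Submodule.span F {a, b}, χ v = 0) :
    Submodule.span F
      {A : Matrix (Fin n) (Fin n) F | ∃ x y : Fin n → F,
        LinearIndependent F ![x, y] ∧
        (∀ v ∈ Submodule.span F {x, y}, χ v = 0) ∧
        A = vecMulVec x y - vecMulVec y x} =
    Submodule.span F
      {A : Matrix (Fin n) (Fin n) F | ∃ x y : Fin n → F,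
        LinearIndependent F ![x, y] ∧
        (∀ u ∈ Submodule.span F {x, y}, ∀ v ∈ Submodule.span F {x, y},
          QuadraticMap.polar χ u v = 0) ∧
        A = vecMulVec x y - vecMulVec y x} := by
  apply le_antisymm
  · refine Submodule.span_mono ?_
    rintro A ⟨x, y, hxy, hs, rfl⟩
    refine ⟨x, y, hxy, fun u hu v hv => ?_, rfl⟩
    rw [QuadraticMap.polar, hs _ (add_mem hu hv), hs _ hu, hs _ hv, sub_zero, sub_zero]
  · rw [Submodule.span_le]
    rintro A ⟨x, y, hxy, hs, rfl⟩
    obtain ⟨a, b, hab, hQ⟩ := hWitt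
    obtain ⟨e₁, f₁, e₂, f₂, he₁, hf₁, he₂, hf₂, h₁, h₂, hee, hef, hfe, hff⟩ :=
      QuadraticMap.exists_two_hyperbolic_pairs χ hns hab hQ
    set T := Submodule.span F
      {A : Matrix (Fin n) (Fin n) F | ∃ x y : Fin n → F,
        LinearIndependent F ![x, y] ∧
        (∀ v ∈ Submodule.span F {x, y}, χ v = 0) ∧
        A = vecMulVec x y - vecMulVec y x} with hT
    have hC : ((vecMulVecSub F (Fin n)).compr₂ T.mkQ).IsAlt := fun x => by
      simp [vecMulVecSub_isAlt x]
    have := hC.eq_polar_smul χ (fun x y hx hy hp => by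
        by_cases hli : LinearIndependent F ![x, y]
        · rw [LinearMap.compr₂_apply, Submodule.mkQ_apply, Submodule.Quotient.mk_eq_zero]
          exact Submodule.subset_span
            ⟨x, y, hli, QuadraticMap.eq_zero_of_mem_span_pair χ hx hy hp, rfl⟩
        · simp [vecMulVecSub_eq_zero hli])
      he₁ hf₁ he₂ hf₂ h₁ h₂ hee hef hfe hff x y
    rwa [hs x (Submodule.subset_span (by simp)) y (Submodule.subset_span (by simp)), zero_smul,
      LinearMap.compr₂_apply, Submodule.mkQ_apply, Submodule.Quotient.mk_eq_zero] at this
end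

section
/- Let F be any field and let Φ be the 4×4 matrix over F with Φ₁₃ = Φ₂₄ = 1, Φ₃₁ = Φ₄₂ = −1, and all other entries 0 (a non-degenerate alternating Gram matrix). Let X be any 4×4 matrix over F with Xᵀ = −X and all diagonal entries 0. Then X·Φ·X = 0 if and only if both X₁₃ + X₂₄ = 0 and X₁₂·X₃₄ + X₁₃² + X₁₄·X₂₃ = 0. -/
open Matrix

/-- Subsection 4.2.1: for the non-degenerate alternating Gram matrix `Φ` on
`F⁴`, an alternating matrix `X` satisfies `X Φ X = O` iff
`X₁₃ + X₂₄ = 0` and `X₁₂X₃₄ + X₁₃² + X₁₄X₂₃ = 0`. -/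
theorem stmt_11 (F : Type*) [Field F]
    (Φ : Matrix (Fin 4) (Fin 4) F)
    (hΦ : Φ = !![0, 0, 1, 0; 0, 0, 0, 1; -1, 0, 0, 0; 0, -1, 0, 0])
    (X : Matrix (Fin 4) (Fin 4) F)
    (hXT : Xᵀ = -X) (hXdiag : ∀ i, X i i = 0) :
    X * Φ * X = 0 ↔
      (X 0 2 + X 1 3 = 0 ∧
        X 0 1 * X 2 3 + X 0 2 ^ 2 + X 0 3 * X 1 2 = 0) := by
  have skew : ∀ i j, X j i = -X i j := fun i j => congrFun (congrFun hXT i) j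
  have entry : ∀ i j, (X * Φ * X) i j =
      X i 0 * X 2 j + X i 1 * X 3 j - X i 2 * X 0 j - X i 3 * X 1 j := by
    intro i j
    subst hΦ
    simp [Matrix.mul_apply, Fin.sum_univ_four]
    ring
  have h10 := skew 0 1
  have h20 := skew 0 2
  have h30 := skew 0 3
  have h21 := skew 1 2
  have h31 := skew 1 3
  have h32 := skew 2 3
  have d0 := hXdiag 0
  have d1 := hXdiag 1
  have d2 := hXdiag 2
  have d3 := hXdiag 3
  constructor
  · intro h
    have e : ∀ i j, X i 0 * X 2 j + X i 1 * X 3 j - X i 2 * X 0 j - X i 3 * X 1 j = 0 := by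
      intro i j
      rw [← entry, h, Matrix.zero_apply]
    have e01 := e 0 1
    have e02 := e 0 2
    have e03 := e 0 3
    have e13 := e 1 3
    simp only [h10, h21, h31, h32, d0, d1, d2, d3] at e01 e02 e03 e13
    have hq : X 0 1 * X 2 3 + X 0 2 ^ 2 + X 0 3 * X 1 2 = 0 := by linear_combination -e02
    refine ⟨?_, hq⟩
    by_contra hs
    have ha : X 0 1 = 0 :=
      (mul_eq_zero.mp (by linear_combination -e01 : X 0 1 * (X 0 2 + X 1 3) = 0)).resolve_right hs
    have hc : X 0 3 = 0 :=
      (mul_eq_zero.mp (by linear_combination -e03 : X 0 3 * (X 0 2 + X 1 3) = 0)).resolve_right hs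
    have hb : X 0 2 = 0 := by simpa [ha, hc] using hq
    have he : X 1 3 = 0 := by simpa [ha, hc] using e13
    exact hs (by rw [hb, he, add_zero])
  · rintro ⟨hs, hq⟩
    have he : X 1 3 = -X 0 2 := by linear_combination hs
    ext i j
    rw [entry, Matrix.zero_apply]
    fin_cases i <;> fin_cases j <;>
      simp only [Fin.zero_eta, Fin.mk_one, Fin.reduceFinMk, h10, h20, h30, h21, h31, h32,
        d0, d1, d2, d3, he] <;>
      first
      | ring1
      | linear_combination hq
      | linear_combination -hq
end

section
/- Let F be any field and let Φ be the 4×4 matrix over F with Φ₁₃ = Φ₂₄ = 1, Φ₃₁ = Φ₄₂ = −1, and all other entries 0. If X is a 4×4 matrix over F with Xᵀ = −X, all diagonal entries 0, and X·Φ·X = 0, then X satisfies the Plücker relation X₁₂·X₃₄ − X₁₃·X₂₄ + X₁₄·X₂₃ = 0. -/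
open Matrix

/-- Subsection 4.2.1: for the non-degenerate alternating Gram matrix `Φ` on
`F⁴`, every alternating matrix `X` with `X Φ X = O` satisfies the Plücker
relation `X₁₂X₃₄ − X₁₃X₂₄ + X₁₄X₂₃ = 0`. -/
theorem stmt_12 (F : Type*) [Field F]
    (Φ : Matrix (Fin 4) (Fin 4) F)
    (hΦ : Φ = !![0, 0, 1, 0; 0, 0, 0, 1; -1, 0, 0, 0; 0, -1, 0, 0])
    (X : Matrix (Fin 4) (Fin 4) F)
    (hXT : Xᵀ = -X) (hXdiag : ∀ i, X i i = 0)
    (hXΦX : X * Φ * X = 0) :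
    X 0 1 * X 2 3 - X 0 2 * X 1 3 + X 0 3 * X 1 2 = 0 := by
  have entry (i j : Fin 4) :
      X i 0 * X 2 j + X i 1 * X 3 j - X i 2 * X 0 j - X i 3 * X 1 j = 0 := by
    have h := congrFun (congrFun hXΦX i) j
    simp only [hΦ, Matrix.mul_apply, Fin.sum_univ_four, Matrix.zero_apply] at h
    simp at h
    linear_combination h
  have skew (i j : Fin 4) : X j i = -X i j := congrFun (congrFun hXT i) j
  have h01 := entry 0 1
  have h02 := entry 0 2
  have h03 := entry 0 3
  simp only [hXdiag, skew 1 2, skew 1 3, skew 2 3] at h01 h02 h03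
  by_cases hs : X 0 2 + X 1 3 = 0
  · linear_combination -h02 - X 0 2 * hs
  · have ha : X 0 1 = 0 := by
      refine (mul_eq_zero.mp ?_).resolve_right hs
      linear_combination -h01
    have hc : X 0 3 = 0 := by
      refine (mul_eq_zero.mp ?_).resolve_right hs
      linear_combination -h03
    have hb : X 0 2 = 0 := by
      refine mul_self_eq_zero.mp ?_
      linear_combination -h02 - X 2 3 * ha - X 1 2 * hc
    simp [ha, hb, hc]
end

section
/- Let F be a field, n ≥ 2, and let a, b ∈ Fⁿ be linearly independent. Let S_a be the F-linear span of {a·vᵀ − v·aᵀ : v ∈ Fⁿ} and S_b the F-linear span of {b·vᵀ − v·bᵀ : v ∈ Fⁿ}. Then S_a ∩ S_b is the one-dimensional span of the single matrix a·bᵀ − b·aᵀ, and consequently the sum S_a + S_b has dimension 2n − 3. -/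
open Matrix

/-- The linear map `v ↦ avᵀ - vaᵀ`, i.e. `v ↦ a ∧ v` in terms of alternating matrices. -/
def wedgeLeft {F ι : Type*} [Field F] (a : ι → F) : (ι → F) →ₗ[F] Matrix ι ι F where
  toFun v := vecMulVec a v - vecMulVec v a
  map_add' v w := by
    rw [vecMulVec_add, add_vecMulVec]
    abel
  map_smul' c v := by
    simp [vecMulVec_smul, smul_vecMulVec, smul_sub]

section wedgeLeft

variable {F ι : Type*} [Field F]

theorem wedgeLeft_apply (a v : ι → F) :
    wedgeLeft a v = vecMulVec a v - vecMulVec v a := rfl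

theorem wedgeLeft_self (a : ι → F) : wedgeLeft a a = 0 := sub_self _

theorem wedgeLeft_swap (a b : ι → F) : wedgeLeft b a = -wedgeLeft a b :=
  (neg_sub _ _).symm

theorem span_vecMulVec_sub_eq_range_wedgeLeft (a : ι → F) :
    Submodule.span F {A : Matrix ι ι F | ∃ v : ι → F, A = vecMulVec a v - vecMulVec v a} =
      LinearMap.range (wedgeLeft a) := by
  have h : {A : Matrix ι ι F | ∃ v : ι → F, A = vecMulVec a v - vecMulVec v a} =
      (LinearMap.range (wedgeLeft a) : Set (Matrix ι ι F)) := by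
    ext A
    simp [wedgeLeft_apply, eq_comm]
  rw [h, Submodule.span_eq]

variable [Fintype ι]

theorem wedgeLeft_mulVec (a v φ : ι → F) :
    wedgeLeft a v *ᵥ φ = (v ⬝ᵥ φ) • a - (a ⬝ᵥ φ) • v := by
  simp [wedgeLeft_apply, sub_mulVec, vecMulVec_mulVec]

theorem exists_dotProduct_eq_one_eq_zero {a b : ι → F} (h : LinearIndependent F ![a, b]) :
    ∃ φ : ι → F, a ⬝ᵥ φ = 1 ∧ b ⬝ᵥ φ = 0 := by
  classical
  have ha : a ∉ Submodule.span F {b} := by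
    rw [Submodule.mem_span_singleton]
    rintro ⟨c, hc⟩
    have := LinearIndependent.pair_iff.mp h 1 (-c) (by simp [hc])
    simp at this
  obtain ⟨f, hfa, hf⟩ := Submodule.exists_le_ker_of_notMem ha
  have hfb : f b = 0 := hf (Submodule.mem_span_singleton_self b)
  obtain ⟨φ, rfl⟩ := (dotProductEquiv F ι).surjective f
  simp only [dotProductEquiv_apply_apply] at hfa hfb
  refine ⟨(φ ⬝ᵥ a)⁻¹ • φ, ?_, ?_⟩
  · rw [dotProduct_smul, dotProduct_comm a, smul_eq_mul, inv_mul_cancel₀ hfa]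
  · rw [dotProduct_smul, dotProduct_comm b, hfb, smul_zero]

theorem ker_wedgeLeft {a φ : ι → F} (h : a ⬝ᵥ φ = 1) :
    LinearMap.ker (wedgeLeft a) = Submodule.span F {a} := by
  apply le_antisymm
  · intro v hv
    have hv' := wedgeLeft_mulVec a v φ
    rw [LinearMap.mem_ker.mp hv, zero_mulVec, h, one_smul] at hv'
    exact Submodule.mem_span_singleton.mpr ⟨_, sub_eq_zero.mp hv'.symm⟩
  · simp [Submodule.span_le, wedgeLeft_self]

theorem finrank_range_wedgeLeft_add_one {a φ : ι → F} (h : a ⬝ᵥ φ = 1) :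
    Module.finrank F (LinearMap.range (wedgeLeft a)) + 1 = Fintype.card ι := by
  have ha : a ≠ 0 := by
    rintro rfl
    simp at h
  have := LinearMap.finrank_range_add_finrank_ker (wedgeLeft a)
  rwa [ker_wedgeLeft h, finrank_span_singleton ha, Module.finrank_fintype_fun_eq_card] at this

theorem range_wedgeLeft_inf_range_wedgeLeft {a b φ : ι → F} (ha : a ⬝ᵥ φ = 1)
    (hb : b ⬝ᵥ φ = 0) :
    LinearMap.range (wedgeLeft a) ⊓ LinearMap.range (wedgeLeft b) =
      Submodule.span F {wedgeLeft a b} := by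
  apply le_antisymm
  · rintro _ ⟨⟨v, rfl⟩, w, hw⟩
    have h : (w ⬝ᵥ φ) • b = (v ⬝ᵥ φ) • a - v := by
      simpa [wedgeLeft_mulVec, ha, hb] using congrArg (· *ᵥ φ) hw
    have hv : v = (v ⬝ᵥ φ) • a - (w ⬝ᵥ φ) • b := by
      rw [h, sub_sub_cancel]
    refine Submodule.mem_span_singleton.mpr ⟨-(w ⬝ᵥ φ), ?_⟩
    conv_rhs => rw [hv]
    simp [wedgeLeft_self]
  · rw [Submodule.span_singleton_le_iff_mem]
    exact ⟨⟨b, rfl⟩, -a, by rw [map_neg, wedgeLeft_swap, neg_neg]⟩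

end wedgeLeft

/-- Subsection 3.1: for linearly independent `a, b ∈ Fⁿ`, the subspaces
`S_a = ⟨{avᵀ − vaᵀ}⟩` and `S_b = ⟨{bvᵀ − vbᵀ}⟩` meet exactly in the line
spanned by `abᵀ − baᵀ`, and `S_a + S_b` (the tangent space of the Grassmann
variety at `[a∧b]`) has dimension `2n − 3`. -/
theorem stmt_15 (F : Type*) [Field F] (n : ℕ) (hn : 2 ≤ n)
    (a b : Fin n → F) (hab : LinearIndependent F ![a, b])
    (Sa Sb : Submodule F (Matrix (Fin n) (Fin n) F))
    (hSa : Sa = Submodule.span F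
      {A : Matrix (Fin n) (Fin n) F | ∃ v : Fin n → F,
        A = vecMulVec a v - vecMulVec v a})
    (hSb : Sb = Submodule.span F
      {A : Matrix (Fin n) (Fin n) F | ∃ v : Fin n → F,
        A = vecMulVec b v - vecMulVec v b}) :
    Sa ⊓ Sb = Submodule.span F {vecMulVec a b - vecMulVec b a} ∧
    Module.finrank F ↥(Sa ⊔ Sb) = 2 * n - 3 := by
  obtain ⟨φ, ha, hb⟩ := exists_dotProduct_eq_one_eq_zero hab
  have hba : LinearIndependent F ![b, a] := LinearIndependent.pair_symm_iff.mp hab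
  obtain ⟨ψ, hb', -⟩ :=
    exists_dotProduct_eq_one_eq_zero hba
  rw [span_vecMulVec_sub_eq_range_wedgeLeft] at hSa hSb
  subst hSa hSb
  have hinf := range_wedgeLeft_inf_range_wedgeLeft ha hb
  refine ⟨hinf, ?_⟩
  have hne : wedgeLeft a b ≠ 0 := by
    intro h
    have h' := wedgeLeft_mulVec a b φ
    rw [h, zero_mulVec, ha, hb, zero_smul, one_smul, zero_sub, eq_comm, neg_eq_zero] at h'
    simp [h'] at hb'
  have hdim := Submodule.finrank_sup_add_finrank_inf_eq
    (LinearMap.range (wedgeLeft a)) (LinearMap.range (wedgeLeft b))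
  rw [hinf, finrank_span_singleton hne] at hdim
  have hra := finrank_range_wedgeLeft_add_one ha
  have hrb := finrank_range_wedgeLeft_add_one hb'
  rw [Fintype.card_fin] at hra hrb
  omega
end

section
/- Let F be a field of characteristic 2 and let χ be the quadratic form on F⁵ given by χ(x₁,…,x₅) = x₁x₂ + x₃x₄ + x₅². Let Φ be the Gram matrix of its polar form, i.e. the 5×5 matrix with Φ₁₂ = Φ₂₁ = Φ₃₄ = Φ₄₃ = 1 and all other entries 0. Let X be a 5×5 matrix over F with Xᵀ = −X and all diagonal entries 0, and suppose that Φ·X·Φ·X = 0 and that χ applied to the k-th column of X equals 0 for every k ∈ {1,…,5}. Then X satisfies all the Plücker relations: Xᵢⱼ·X_{kh} + Xᵢₖ·X_{jh} + Xᵢₕ·X_{jk} = 0 for all 1 ≤ i < j < k < h ≤ 5. -/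
open Matrix

/-- Subsection 4.1.2: in characteristic 2, for `χ(x) = x₁x₂ + x₃x₄ + x₅²` on
`F⁵` with Gram matrix `Φ` of its polar form, every alternating matrix `X`
with `Φ X Φ X = O` and `χ` vanishing on all columns of `X` satisfies all the
Plücker relations. -/
theorem stmt_16 (F : Type*) [Field F] [CharP F 2]
    (χ : (Fin 5 → F) → F)
    (hχ : ∀ v : Fin 5 → F, χ v = v 0 * v 1 + v 2 * v 3 + v 4 ^ 2)
    (Φ : Matrix (Fin 5) (Fin 5) F)
    (hΦ : Φ = !![0, 1, 0, 0, 0; 1, 0, 0, 0, 0; 0, 0, 0, 1, 0;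
                 0, 0, 1, 0, 0; 0, 0, 0, 0, 0])
    (X : Matrix (Fin 5) (Fin 5) F)
    (hXT : Xᵀ = -X) (hXdiag : ∀ i, X i i = 0)
    (hΦX : Φ * X * Φ * X = 0)
    (hcol : ∀ k : Fin 5, χ (fun i => X i k) = 0) :
    ∀ i j k h : Fin 5, i < j → j < k → k < h →
      X i j * X k h + X i k * X j h + X i h * X j k = 0 := by
  have hskew (i j : Fin 5) : X j i = X i j := by
    simpa only [transpose_apply, neg_apply, CharTwo.neg_eq] using congrFun (congrFun hXT i) j
  have hprod (r s : Fin 5) : (Φ * X * Φ * X) r s = 0 := congrFun (congrFun hΦX r) s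
  simp only [mul_apply, Fin.sum_univ_five] at hprod
  have h01 := hprod 1 1
  have h04 := hprod 1 4
  have h14 := hprod 0 4
  have h23 := hprod 3 3
  have h24 := hprod 3 4
  have h34 := hprod 2 4
  simp [hΦ, hXdiag, hskew 0 1, hskew 0 2, hskew 0 3, hskew 0 4, hskew 1 2, hskew 1 3,
    hskew 1 4, hskew 2 3, hskew 2 4, hskew 3 4] at h01 h04 h14 h23 h24 h34
  have hsq : (X 0 1 + X 2 3) ^ 2 = 0 := by
    linear_combination h01 + h23 + (X 0 1 * X 2 3 - X 0 2 * X 1 3 - X 0 3 * X 1 2) *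
      CharTwo.two_eq_zero (R := F)
  have hdiag : X 0 1 = X 2 3 := CharTwo.add_eq_zero.mp (eq_zero_of_pow_eq_zero hsq)
  intro i j k h hij hjk hkh
  fin_cases i <;> fin_cases j <;> fin_cases k <;> fin_cases h <;> simp at hij hjk hkh ⊢
  · linear_combination h01 - X 0 1 * hdiag
  · linear_combination h24 + X 2 4 * hdiag
  · linear_combination h34 + X 3 4 * hdiag
  · linear_combination h04 - X 0 4 * hdiag
  · linear_combination h14 - X 1 4 * hdiag
end

section
/- Let F be a field, n ≥ 2, σ a ring automorphism of F with σ∘σ = id, and ε ∈ F with σ(ε)·ε = 1. Let Φ be an n×n matrix over F with Φᵀ = ε·Φ^σ, where Φ^σ denotes entrywise application of σ. For z ∈ Fⁿ define λ(z) = ε·Φ^σ·z^σ ∈ Fⁿ, where z^σ is the entrywise application of σ to z. Then for all x, y ∈ Fⁿ: λ(x)·λ(y)ᵀ − λ(y)·λ(x)ᵀ = ε · Φ^σ · (x·yᵀ − y·xᵀ)^σ · Φ, where (·)^σ on a matrix means entrywise application of σ. -/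
open Matrix

/-- Equation (10): for the semilinear map `λ(z) = ε Φ^σ z^σ` associated with a
`(σ,ε)`-sesquilinear form with Gram matrix `Φ`,
`λ(x)λ(y)ᵀ − λ(y)λ(x)ᵀ = ε Φ^σ (xyᵀ − yxᵀ)^σ Φ`. -/
theorem stmt_17 (F : Type*) [Field F] (n : ℕ) (hn : 2 ≤ n)
    (σ : F ≃+* F) (hσ : ∀ t, σ (σ t) = t)
    (ε : F) (hε : σ ε * ε = 1)
    (Φ : Matrix (Fin n) (Fin n) F) (hΦ : Φᵀ = ε • Φ.map σ)
    (lam : (Fin n → F) → (Fin n → F))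
    (hlam : ∀ z : Fin n → F, lam z = ε • (Φ.map σ *ᵥ fun i => σ (z i)))
    (x y : Fin n → F) :
    vecMulVec (lam x) (lam y) - vecMulVec (lam y) (lam x) =
      ε • (Φ.map σ * (vecMulVec x y - vecMulVec y x).map σ * Φ) := by
  have hlam' (z : Fin n → F) : lam z = Φᵀ *ᵥ fun i => σ (z i) := by
    rw [hlam, hΦ, smul_mulVec]
  have key (u v : Fin n → F) : vecMulVec (lam u) (lam v) =
      ε • (Φ.map σ * (vecMulVec u v).map σ * Φ) := by
    have hmap : (vecMulVec u v).map σ = vecMulVec (fun i => σ (u i)) fun i => σ (v i) := by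
      ext i j
      simp [vecMulVec_apply]
    rw [hlam' u, hlam' v, mulVec_transpose Φ (fun i => σ (v i)), ← vecMulVec_mul,
      ← mul_vecMulVec, hΦ, hmap, smul_mul, smul_mul]
  rw [key, key, Matrix.map_sub σ (map_sub σ), Matrix.mul_sub, Matrix.sub_mul, smul_sub]
end
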